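/- (Écalle–Hakim) Let f be a holomorphic local dynamical system at O ∈ ℂⁿ tangent to the identity of order ν ≥ 2, with homogeneous expansion f(z) = z + P_ν(z) + ⋯. Then for any non-degenerate characteristic direction [v] ∈ ℙ^{n−1}(ℂ) (i.e. P_ν(v) = λv with λ ≠ 0) there exist at least ν − 1 parabolic curves for f tangent to [v]. -/

import Mathlib

open Set Filter Topology

/-- The quotient topology on the complex projective space `ℙ^{n-1}(ℂ)`. -/
noncomputable instance (n : ℕ) : TopologicalSpace (Projectivization ℂ (Fin n → ℂ)) :=
  inferInstanceAs (TopologicalSpace (Quotient _))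

/-- `φ : Δ → ℂⁿ \ {O}` is a parabolic curve for `f` (defined on `U`) tangent to the direction
`[v]`: `Δ ⊂ ℂ` is a simply connected domain with `0` on its boundary, `φ` is an injective
holomorphic map continuous at `0` with `φ(0) = O`, the image `φ(Δ)` is `f`-invariant, the
iterates of `f` on it converge to `O` uniformly on compact subsets, and `[φ(ζ)] → [v]` in
`ℙ^{n-1}(ℂ)` as `ζ → 0` in `Δ`. -/
def IsParabolicCurve {n : ℕ} (f : (Fin n → ℂ) → Fin n → ℂ) (U : Set (Fin n → ℂ))
    (Δ : Set ℂ) (φ : ℂ → Fin n → ℂ) (v : Fin n → ℂ) (hv : v ≠ 0) : Prop :=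
  IsOpen Δ ∧ Δ.Nonempty ∧ IsConnected Δ ∧ SimplyConnectedSpace Δ ∧
    (0 : ℂ) ∈ frontier Δ ∧ (0 : ℂ) ∉ Δ ∧
    DifferentiableOn ℂ φ Δ ∧ Set.InjOn φ Δ ∧
    (∀ ζ ∈ Δ, φ ζ ≠ 0) ∧ φ '' Δ ⊆ U ∧
    Tendsto φ (𝓝[Δ] 0) (𝓝 0) ∧
    Set.MapsTo f (φ '' Δ) (φ '' Δ) ∧
    (∀ K ⊆ φ '' Δ, IsCompact K →
      TendstoUniformlyOn (fun (k : ℕ) z => f^[k] z) (fun _ => 0) atTop K) ∧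
    Tendsto
      (fun ζ => if h : φ ζ ≠ 0 then Projectivization.mk ℂ (φ ζ) h
                else Projectivization.mk ℂ v hv)
      (𝓝[Δ] 0) (𝓝 (Projectivization.mk ℂ v hv))

namespace EcalleHakim

open Complex Metric Asymptotics

variable {E F : Type*} [NormedAddCommGroup E] [NormedSpace ℂ E]
  [NormedAddCommGroup F] [NormedSpace ℂ F]

/-- The half-strip `{u : R < Re u, |Im u| < θ}`. -/
def strip (θ R : ℝ) : Set ℂ := {u | R < u.re ∧ |u.im| < θ}

/-- The filter of neighbourhoods of the right end of the strip `|Im u| < θ`. -/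
def stripEnd (θ : ℝ) : Filter ℂ := comap re atTop ⊓ 𝓟 {u | |u.im| < θ}

lemma hasBasis_stripEnd (θ : ℝ) : (stripEnd θ).HasBasis (fun _ : ℝ => True) (strip θ) := by
  have := ((atTop_basis_Ioi (α := ℝ)).comap re).inf_principal {u : ℂ | |u.im| < θ}
  exact this.congr (fun _ => Iff.rfl) (fun R _ => rfl)

lemma eventually_stripEnd {θ : ℝ} {p : ℂ → Prop} :
    (∀ᶠ u in stripEnd θ, p u) ↔ ∃ R, ∀ u ∈ strip θ R, p u := by
  simp [(hasBasis_stripEnd θ).eventually_iff]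

lemma tendsto_re_stripEnd (θ : ℝ) : Tendsto re (stripEnd θ) atTop :=
  tendsto_comap.mono_left inf_le_left

lemma stripEnd_mono {θ θ' : ℝ} (h : θ' ≤ θ) : stripEnd θ' ≤ stripEnd θ :=
  inf_le_inf_left _ (principal_mono.2 fun _ hu => lt_of_lt_of_le hu h)

lemma eventually_im_stripEnd (θ : ℝ) : ∀ᶠ u in stripEnd θ, |u.im| < θ :=
  eventually_stripEnd.2 ⟨0, fun _ hu => hu.2⟩

lemma isOpen_strip (θ R : ℝ) : IsOpen (strip θ R) :=
  (isOpen_lt continuous_const continuous_re).inter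
    (isOpen_lt (continuous_abs.comp continuous_im) continuous_const)

lemma convex_strip (θ R : ℝ) : Convex ℝ (strip θ R) := by
  have h1 : Convex ℝ {u : ℂ | R < u.re} := convex_halfSpace_re_gt R
  have h2 : Convex ℝ {u : ℂ | -θ < u.im} := convex_halfSpace_im_gt (-θ)
  have h3 : Convex ℝ {u : ℂ | u.im < θ} := convex_halfSpace_im_lt θ
  convert h1.inter (h2.inter h3) using 1
  ext u
  simp [strip, abs_lt]

lemma eventually_stripEnd_ball {θ : ℝ} {p : ℂ → Prop} (h : ∀ᶠ u in stripEnd (θ + 1), p u) :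
    ∀ᶠ u in stripEnd θ, ∀ w ∈ ball u 1, p w := by
  obtain ⟨R, hR⟩ := eventually_stripEnd.1 h
  refine eventually_stripEnd.2 ⟨R + 1, fun u hu w hw => hR w ?_⟩
  rw [mem_ball, dist_eq_norm] at hw
  have h1 := (abs_re_le_norm (w - u)).trans_lt hw
  have h2 := (abs_im_le_norm (w - u)).trans_lt hw
  rw [sub_re, abs_lt] at h1
  rw [sub_im] at h2
  have h3 := abs_sub_abs_le_abs_sub w.im u.im
  obtain ⟨h4, h5⟩ := hu
  exact ⟨by linarith, by linarith⟩

lemma tendsto_exp_neg_re_stripEnd (θ : ℝ) {a : ℝ} (ha : 0 < a) :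
    Tendsto (fun u : ℂ => Real.exp (-a * u.re)) (stripEnd θ) (𝓝 0) := by
  refine Real.tendsto_exp_atBot.comp ?_
  exact (tendsto_re_stripEnd θ).const_mul_atTop_of_neg (by linarith)

/-- `g` is holomorphic near the right end of the strip `|Im u| < θ`,
and `O(e^{- a Re u})` there. -/
def ExpDecay (θ a : ℝ) (g : ℂ → E) : Prop :=
  (∀ᶠ u in stripEnd θ, DifferentiableAt ℂ g u) ∧
    g =O[stripEnd θ] fun u => Real.exp (-a * u.re)

lemma isBigO_exp_rate (θ : ℝ) {a a' : ℝ} (h : a' ≤ a) :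
    (fun u : ℂ => Real.exp (-a * u.re)) =O[stripEnd θ] fun u => Real.exp (-a' * u.re) := by
  refine IsBigO.of_bound 1 ?_
  filter_upwards [(tendsto_re_stripEnd θ).eventually_ge_atTop 0] with u hu
  rw [one_mul, Real.norm_of_nonneg (Real.exp_pos _).le, Real.norm_of_nonneg (Real.exp_pos _).le]
  exact Real.exp_le_exp.2 (by nlinarith)

lemma ExpDecay.mono_rate {θ a a' : ℝ} {g : ℂ → E} (h : ExpDecay θ a g) (ha : a' ≤ a) :
    ExpDecay θ a' g :=
  ⟨h.1, h.2.trans (isBigO_exp_rate θ ha)⟩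

lemma ExpDecay.mono_width {θ θ' a : ℝ} {g : ℂ → E} (h : ExpDecay θ a g) (hθ : θ' ≤ θ) :
    ExpDecay θ' a g :=
  ⟨h.1.filter_mono (stripEnd_mono hθ), h.2.mono (stripEnd_mono hθ)⟩

lemma ExpDecay.add {θ a : ℝ} {g k : ℂ → E} (hg : ExpDecay θ a g) (hk : ExpDecay θ a k) :
    ExpDecay θ a (fun u => g u + k u) :=
  ⟨by filter_upwards [hg.1, hk.1] with u h1 h2 using h1.add h2, hg.2.add hk.2⟩

lemma ExpDecay.sub {θ a : ℝ} {g k : ℂ → E} (hg : ExpDecay θ a g) (hk : ExpDecay θ a k) :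
    ExpDecay θ a (fun u => g u - k u) :=
  ⟨by filter_upwards [hg.1, hk.1] with u h1 h2 using h1.sub h2, hg.2.sub hk.2⟩

lemma ExpDecay.neg {θ a : ℝ} {g : ℂ → E} (hg : ExpDecay θ a g) :
    ExpDecay θ a (fun u => -g u) :=
  ⟨by filter_upwards [hg.1] with u h1 using h1.neg, hg.2.neg_left⟩

lemma ExpDecay.clm {θ a : ℝ} {g : ℂ → E} (hg : ExpDecay θ a g) (B : E →L[ℂ] F) :
    ExpDecay θ a (fun u => B (g u)) :=
  ⟨by filter_upwards [hg.1] with u h1 using B.differentiableAt.comp u h1,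
    (B.isBigO_comp g _).trans hg.2⟩

lemma expDecay_const (θ : ℝ) (x : E) : ExpDecay θ 0 (fun _ => x) := by
  refine ⟨by simp, ?_⟩
  simp only [neg_zero, zero_mul, Real.exp_zero]
  exact isBigO_const_const x one_ne_zero _

lemma norm_exp_mul_le {θ : ℝ} (β u : ℂ) (hu : |u.im| < θ) :
    ‖exp (-β * u)‖ ≤ Real.exp (|β.im| * θ) * Real.exp (-β.re * u.re) := by
  rw [norm_exp, ← Real.exp_add]
  refine Real.exp_le_exp.2 ?_
  have h1 : β.im * u.im ≤ |β.im| * θ :=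
    (le_abs_self _).trans (by rw [abs_mul]; gcongr)
  simp only [mul_re, neg_re, neg_im]
  linarith

lemma ExpDecay.exp_smul {θ a : ℝ} {g : ℂ → E} (hg : ExpDecay θ a g) (β : ℂ) :
    ExpDecay θ (a + β.re) (fun u => exp (-β * u) • g u) := by
  constructor
  · filter_upwards [hg.1] with u hu
    exact DifferentiableAt.smul (by fun_prop) hu
  · have h1 : (fun u : ℂ => exp (-β * u)) =O[stripEnd θ] fun u => Real.exp (-β.re * u.re) := by
      refine IsBigO.of_bound (Real.exp (|β.im| * θ)) ?_
      filter_upwards [eventually_im_stripEnd θ] with u hu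
      rw [Real.norm_of_nonneg (Real.exp_pos _).le]
      exact norm_exp_mul_le β u hu
    refine (h1.smul hg.2).congr_right fun u => ?_
    rw [smul_eq_mul, ← Real.exp_add]
    ring_nf

lemma ExpDecay.exists_bound_ball {θ a : ℝ} {g : ℂ → E} (hg : ExpDecay (θ + 1) a g) :
    ∃ C > 0, ∀ᶠ u in stripEnd θ, ∀ w ∈ ball u 1,
      DifferentiableAt ℂ g w ∧ ‖g w‖ ≤ C * Real.exp (-a * u.re) := by
  obtain ⟨C, hC, hb⟩ := hg.2.exists_pos
  refine ⟨C * Real.exp |a|, by positivity, ?_⟩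
  filter_upwards [eventually_stripEnd_ball (hg.1.and hb.bound)] with u hu w hw
  refine ⟨(hu w hw).1, (hu w hw).2.trans ?_⟩
  rw [Real.norm_of_nonneg (Real.exp_pos _).le, mul_assoc, ← Real.exp_add]
  gcongr
  rw [mem_ball, dist_eq_norm] at hw
  have h1 := (abs_re_le_norm (w - u)).trans hw.le
  have h2 : |a * (w - u).re| ≤ |a| * 1 := by rw [abs_mul]; gcongr
  have h3 := neg_abs_le (a * (w - u).re)
  rw [sub_re, mul_sub] at h3 h2
  linarith

lemma ExpDecay.deriv [CompleteSpace E] {θ a : ℝ} {g : ℂ → E} (hg : ExpDecay (θ + 1) a g) :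
    ExpDecay θ a (deriv g) := by
  obtain ⟨C, hC, hb⟩ := hg.exists_bound_ball
  constructor
  · filter_upwards [hb] with u hu
    have : DifferentiableOn ℂ g (ball u 1) := fun w hw => (hu w hw).1.differentiableWithinAt
    exact (this.deriv isOpen_ball).differentiableAt (ball_mem_nhds u one_pos)
  · refine IsBigO.of_bound (2 * C) ?_
    filter_upwards [hb] with u hu
    have : DifferentiableOn ℂ g (ball u 1) := fun w hw => (hu w hw).1.differentiableWithinAt
    have h2 := norm_deriv_le_div_of_mapsTo_ball this
      (R₂ := 2 * C * Real.exp (-a * u.re)) (fun w hw => ?_) one_pos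
    · rwa [Real.norm_of_nonneg (Real.exp_pos _).le, ← div_one (2 * C * _)]
    · rw [mem_closedBall, dist_eq_norm]
      refine (norm_sub_le _ _).trans ?_
      have := (hu w hw).2
      have := (hu u (mem_ball_self one_pos)).2
      linarith

/-- The increment of `u = log t` when `t` is increased by `1`. -/
noncomputable def logStep (u : ℂ) : ℂ := log (1 + exp (-u))

lemma norm_exp_neg (u : ℂ) : ‖exp (-u)‖ = Real.exp (-u.re) := by
  rw [norm_exp, neg_re]

lemma eventually_exp_neg_small (θ : ℝ) {ε : ℝ} (hε : 0 < ε) :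
    ∀ᶠ u in stripEnd θ, ‖exp (-u)‖ < ε := by
  have := (tendsto_exp_neg_re_stripEnd θ one_pos).eventually_lt_const hε
  filter_upwards [this] with u hu
  rw [norm_exp_neg]
  simpa using hu

lemma eventually_logStep (θ : ℝ) : ∀ᶠ u in stripEnd θ,
    ‖logStep u - exp (-u)‖ ≤ Real.exp (-u.re) ^ 2 ∧ ‖logStep u‖ ≤ 2 * Real.exp (-u.re) ∧
      ‖logStep u‖ < 1 ∧ DifferentiableAt ℂ logStep u := by
  filter_upwards [eventually_exp_neg_small θ (ε := 1 / 2) (by norm_num)] with u hu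
  have h1 := norm_log_one_add_sub_self_le (z := exp (-u)) (by linarith)
  have h2 : ‖logStep u - exp (-u)‖ ≤ ‖exp (-u)‖ ^ 2 := by
    refine h1.trans ?_
    have h3 : (1 - ‖exp (-u)‖)⁻¹ ≤ 2 := by
      rw [inv_le_comm₀ (by linarith) (by norm_num)]; linarith
    nlinarith [sq_nonneg ‖exp (-u)‖]
  have h3 : ‖logStep u‖ ≤ ‖logStep u - exp (-u)‖ + ‖exp (-u)‖ := by
    simpa using norm_add_le (logStep u - exp (-u)) (exp (-u))
  have h0 := norm_nonneg (exp (-u))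
  rw [norm_exp_neg] at *
  refine ⟨h2, by nlinarith, by nlinarith, ?_⟩
  refine DifferentiableAt.clog (by fun_prop) ?_
  refine Or.inl ?_
  have := (abs_re_le_norm (exp (-u))).trans_lt (by rw [norm_exp_neg]; exact hu)
  rw [abs_lt] at this
  simp only [add_re, one_re]
  linarith

lemma eventually_shift {θ : ℝ} {p : ℂ → Prop} (h : ∀ᶠ u in stripEnd (θ + 1), p u) :
    ∀ᶠ u in stripEnd θ, p (u + logStep u) := by
  filter_upwards [eventually_stripEnd_ball h, eventually_logStep θ] with u hu h1
  exact hu _ (by simpa using h1.2.2.1)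

lemma ExpDecay.shift {θ a : ℝ} {g : ℂ → E} (hg : ExpDecay (θ + 1) a g) :
    ExpDecay θ a (fun u => g (u + logStep u)) := by
  obtain ⟨C, hC, hb⟩ := hg.exists_bound_ball
  constructor
  · filter_upwards [eventually_shift hg.1, eventually_logStep θ] with u hu h1
    exact DifferentiableAt.comp (f := fun u => u + logStep u) u hu
      (differentiableAt_id.add h1.2.2.2)
  · refine IsBigO.of_bound C ?_
    filter_upwards [hb, eventually_logStep θ] with u hu h1
    rw [Real.norm_of_nonneg (Real.exp_pos _).le]
    exact (hu _ (by simpa using h1.2.2.1)).2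

lemma ExpDecay.taylor [CompleteSpace E] {θ a : ℝ} {g : ℂ → E}
    (hg : ExpDecay (θ + 1 + 1 + 1) a g) :
    ExpDecay θ (a + 2) fun u => g (u + logStep u) - g u - exp (-u) • _root_.deriv g u := by
  have hg2 : ExpDecay (θ + 1 + 1) a g := hg.mono_width (by linarith)
  have hg1 : ExpDecay (θ + 1) a g := hg.mono_width (by linarith)
  refine ⟨?_, ?_⟩
  · filter_upwards [hg1.shift.1, (hg1.mono_width (by linarith) : ExpDecay θ a g).1,
      hg1.deriv.1] with u h1 h2 h3
    exact (h1.sub h2).sub (DifferentiableAt.smul (by fun_prop) h3)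
  obtain ⟨C1, hC1, hb1⟩ := hg2.deriv.exists_bound_ball
  obtain ⟨C2, hC2, hb2⟩ := hg.deriv.deriv.exists_bound_ball
  refine IsBigO.of_bound (4 * C2 + C1) ?_
  filter_upwards [hb1, hb2, eventually_stripEnd_ball hg1.1, eventually_logStep θ]
    with u h1 h2 h0 ⟨hs1, hs2, hs3, hs4⟩
  set M := C2 * Real.exp (-a * u.re) with hM
  set r := ‖logStep u‖ with hr
  have hr0 : 0 ≤ r := norm_nonneg _
  have hsub : closedBall u r ⊆ ball u 1 := closedBall_subset_ball hs3
  have hmem : u + logStep u ∈ closedBall u r := by simp [hr]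
  have hu : u ∈ closedBall u r := mem_closedBall_self hr0
  have hd1 : ∀ w ∈ closedBall u r, ‖_root_.deriv g w - _root_.deriv g u‖ ≤ M * r := by
    intro w hw
    have := (convex_closedBall u r).norm_image_sub_le_of_norm_deriv_le (f := _root_.deriv g)
      (fun x hx => (h1 x (hsub hx)).1) (fun x hx => (h2 x (hsub hx)).2) hu hw
    refine this.trans ?_
    rw [mem_closedBall, dist_eq_norm] at hw
    gcongr
  have hd2 : ‖g (u + logStep u) - g u - logStep u • _root_.deriv g u‖ ≤ M * r * r := by
    have := (convex_closedBall u r).norm_image_sub_le_of_norm_hasDerivWithin_le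
      (f := fun w => g w - w • _root_.deriv g u) (C := M * r)
      (f' := fun w => _root_.deriv g w - (1 : ℂ) • _root_.deriv g u) (fun x hx => ?_)
      (fun x hx => ?_) hu hmem
    · rw [add_sub_cancel_left] at this
      convert this using 2
      simp only [add_smul]
      abel
    · exact ((h0 x (hsub hx)).hasDerivAt.sub
        ((hasDerivAt_id x).smul_const _)).hasDerivWithinAt
    · simpa using hd1 x hx
  have hd3 : ‖(logStep u - exp (-u)) • _root_.deriv g u‖
      ≤ Real.exp (-u.re) ^ 2 * (C1 * Real.exp (-a * u.re)) := by
    rw [norm_smul]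
    gcongr
    exact (h1 u (mem_ball_self one_pos)).2
  have hexp : Real.exp (-(a + 2) * u.re) = Real.exp (-u.re) ^ 2 * Real.exp (-a * u.re) := by
    rw [← Real.exp_nat_mul, ← Real.exp_add]
    congr 1
    push_cast
    ring
  rw [Real.norm_of_nonneg (Real.exp_pos _).le, hexp]
  have : g (u + logStep u) - g u - exp (-u) • _root_.deriv g u
      = (g (u + logStep u) - g u - logStep u • _root_.deriv g u)
        + (logStep u - exp (-u)) • _root_.deriv g u := by
    rw [sub_smul]; abel
  rw [this]
  refine (norm_add_le _ _).trans ((add_le_add hd2 hd3).trans ?_)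
  have h5 : M * r * r ≤ M * (2 * Real.exp (-u.re)) * (2 * Real.exp (-u.re)) := by
    gcongr
  rw [hM] at h5 ⊢
  linarith

lemma norm_sub_le_horizontal {θ R b C : ℝ} (hb : b ≠ 0) {G K : ℂ → E}
    (hG : ∀ u ∈ strip θ R, ‖G u‖ ≤ C * Real.exp (-b * u.re))
    (hK : ∀ u ∈ strip θ R, HasDerivAt K (G u) u) {u : ℂ} (hu : u ∈ strip θ R) {s : ℝ}
    (hs : 0 ≤ s) :
    ‖K (u + s) - K u‖ ≤ C / b * (Real.exp (-b * u.re) - Real.exp (-b * (u.re + s))) := by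
  have hmem : ∀ x : ℝ, 0 ≤ x → u + x ∈ strip θ R := fun x hx =>
    ⟨by simpa using hu.1.trans_le (by linarith), by simpa using hu.2⟩
  have hd : ∀ x : ℝ, 0 ≤ x → HasDerivAt (fun x : ℝ => K (u + x) - K u) (G (u + x)) x := by
    intro x hx
    have h1 : HasDerivAt (fun z : ℂ => K (u + z)) (G (u + x)) (x : ℂ) :=
      HasDerivAt.comp_const_add u (x : ℂ) (hK _ (hmem x hx))
    have h2 : HasDerivAt (fun x : ℝ => (x : ℂ)) 1 x := by
      exact HasDerivAt.ofReal_comp (hasDerivAt_id x)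
    have h3 := h1.scomp x h2
    rw [one_smul] at h3
    exact h3.sub_const _
  refine image_norm_le_of_norm_deriv_right_le_deriv_boundary (a := 0) (b := s)
    (f := fun x : ℝ => K (u + x) - K u) (f' := fun x : ℝ => G (u + x))
    (B := fun x => C / b * (Real.exp (-b * u.re) - Real.exp (-b * (u.re + x))))
    (B' := fun x => C * Real.exp (-b * (u.re + x)))
    (fun x hx => (hd x hx.1).continuousAt.continuousWithinAt)
    (fun x hx => (hd x hx.1).hasDerivWithinAt) (by simp) (fun x => ?_)
    (fun x hx => by simpa using hG _ (hmem x hx.1)) (right_mem_Icc.2 hs)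
  have h2 : HasDerivAt (fun x : ℝ => -b * (u.re + x)) (-b * 1) x :=
    ((hasDerivAt_id x).const_add u.re).const_mul (-b)
  refine ((h2.exp.const_sub (Real.exp (-b * u.re))).const_mul (C / b)).congr_deriv ?_
  field_simp

lemma norm_sub_le_vertical {θ R b C : ℝ} (hC : 0 ≤ C) {G K : ℂ → E}
    (hG : ∀ u ∈ strip θ R, ‖G u‖ ≤ C * Real.exp (-b * u.re))
    (hK : ∀ u ∈ strip θ R, HasDerivAt K (G u) u) {u : ℂ} (hu : u ∈ strip θ R) :
    ‖K u - K (u.re : ℂ)‖ ≤ C * θ * Real.exp (-b * u.re) := by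
  have hθ : 0 < θ := (abs_nonneg _).trans_lt hu.2
  have hconv : Convex ℝ ({w : ℂ | w.re = u.re} ∩ strip θ R) := by
    refine Convex.inter ?_ (convex_strip θ R)
    exact (convex_singleton u.re).is_linear_preimage (f := re) ⟨by simp, by simp⟩
  have := hconv.norm_image_sub_le_of_norm_hasDerivWithin_le (f := K) (f' := G)
    (C := C * Real.exp (-b * u.re)) (x := (u.re : ℂ)) (y := u)
    (fun w hw => (hK w hw.2).hasDerivWithinAt) (fun w hw => ?_)
    ⟨by simp, by simpa using hu.1, by simpa using hθ⟩ ⟨rfl, hu⟩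
  · refine this.trans ?_
    have h1 : ‖u - (u.re : ℂ)‖ ≤ θ := by
      have : u - (u.re : ℂ) = (u.im : ℂ) * I := by
        rw [sub_eq_iff_eq_add']
        exact (re_add_im u).symm
      rw [this]
      simpa using hu.2.le
    calc _ ≤ C * Real.exp (-b * u.re) * θ := by gcongr
      _ = _ := by ring
  · rw [← (show w.re = u.re from hw.1)]
    exact hG w hw.2

lemma ExpDecay.exists_primitive [CompleteSpace E] {θ b : ℝ} (hθ : 0 < θ) (hb : b ≠ 0) {G : ℂ → E}
    (hG : ExpDecay θ b G) :
    ∃ K, ExpDecay θ b K ∧ ∀ᶠ u in stripEnd θ, HasDerivAt K (G u) u := by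
  obtain ⟨C, hC, hbd⟩ := hG.2.exists_pos
  obtain ⟨R, hR⟩ := eventually_stripEnd.1 (hG.1.and hbd.bound)
  obtain ⟨K, hK⟩ := (convex_strip θ R).exists_forall_hasDerivWithinAt (f := G)
    (fun u hu => (hR u hu).1.differentiableWithinAt)
  replace hK : ∀ u ∈ strip θ R, HasDerivAt K (G u) u := fun u hu =>
    (hK u hu).hasDerivAt ((isOpen_strip θ R).mem_nhds hu)
  have hG' : ∀ u ∈ strip θ R, ‖G u‖ ≤ C * Real.exp (-b * u.re) := fun u hu => by
    have := (hR u hu).2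
    rwa [Real.norm_of_nonneg (Real.exp_pos _).le] at this
  suffices h : ∃ L : E, ∃ C', ∀ u ∈ strip θ (R + 1),
      ‖K u - L‖ ≤ C' * Real.exp (-b * u.re) by
    obtain ⟨L, C', hL⟩ := h
    have hd : ∀ u ∈ strip θ R, HasDerivAt (fun u => K u - L) (G u) u := fun u hu =>
      (hK u hu).sub_const L
    refine ⟨fun u => K u - L, ⟨eventually_stripEnd.2 ⟨R, fun u hu =>
      (hd u hu).differentiableAt⟩, IsBigO.of_bound C' (eventually_stripEnd.2
        ⟨R + 1, fun u hu => ?_⟩)⟩, eventually_stripEnd.2 ⟨R, hd⟩⟩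
    rw [Real.norm_of_nonneg (Real.exp_pos _).le]
    exact hL u hu
  have hreal : ∀ x : ℝ, R < x → (x : ℂ) ∈ strip θ R := fun x hx =>
    ⟨by simpa using hx, by simpa using hθ⟩
  rcases lt_or_gt_of_ne hb with hneg | hpos
  · refine ⟨K ((R + 1 : ℝ) : ℂ), C * θ + C / (-b), fun u hu => ?_⟩
    have hu' : u ∈ strip θ R := ⟨by linarith [hu.1], hu.2⟩
    have h1 := norm_sub_le_vertical hC.le hG' hK hu'
    have h2 := norm_sub_le_horizontal hb hG' hK (hreal (R + 1) (by linarith))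
      (s := u.re - (R + 1)) (by linarith [hu.1])
    have h3 : (((R + 1 : ℝ) : ℂ) + ((u.re - (R + 1) : ℝ) : ℂ)) = (u.re : ℂ) := by
      push_cast; ring
    rw [h3, ofReal_re, add_sub_cancel] at h2
    have h4 : ‖K u - K ((R + 1 : ℝ) : ℂ)‖ ≤ _ :=
      (norm_sub_le_norm_sub_add_norm_sub _ (K (u.re : ℂ)) _).trans (add_le_add h1 h2)
    refine h4.trans ?_
    have h5 : 0 ≤ C / (-b) * Real.exp (-b * (R + 1)) := by
      have : 0 < -b := by linarith
      positivity
    have h6 : C / b = -(C / (-b)) := by rw [div_neg, neg_neg]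
    rw [h6]
    linarith
  · have hlim : Tendsto (fun x : ℝ => C / b * Real.exp (-b * x)) atTop (𝓝 0) := by
      have : Tendsto (fun x : ℝ => Real.exp (-b * x)) atTop (𝓝 0) :=
        Real.tendsto_exp_atBot.comp (tendsto_id.const_mul_atTop_of_neg (by linarith))
      simpa using this.const_mul (C / b)
    have hreal2 : ∀ x y : ℝ, R < x → x ≤ y →
        ‖K (y : ℂ) - K (x : ℂ)‖ ≤ C / b * Real.exp (-b * x) := by
      intro x y hx hxy
      have h2 := norm_sub_le_horizontal hb hG' hK (hreal x hx) (s := y - x) (by linarith)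
      have h3 : ((x : ℂ) + ((y - x : ℝ) : ℂ)) = (y : ℂ) := by push_cast; ring
      rw [h3, ofReal_re] at h2
      refine h2.trans ?_
      have : 0 < Real.exp (-b * (x + (y - x))) := Real.exp_pos _
      gcongr
      linarith
    have hcau : CauchySeq (fun s : ℝ => K ((max s (R + 1) : ℝ) : ℂ)) := by
      refine cauchySeq_of_le_tendsto_0' (fun s => C / b * Real.exp (-b * max s (R + 1)))
        (fun s t hst => ?_) (hlim.comp (tendsto_atTop_mono (le_max_left · (R + 1)) tendsto_id))
      rw [dist_comm, dist_eq_norm]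
      exact hreal2 _ _ (lt_of_lt_of_le (by linarith) (le_max_right _ _))
        (max_le_max_right _ hst)
    obtain ⟨L, hL⟩ := cauchySeq_tendsto_of_complete hcau
    refine ⟨L, C * θ + C / b, fun u hu => ?_⟩
    have hu' : u ∈ strip θ R := ⟨by linarith [hu.1], hu.2⟩
    have h1 := norm_sub_le_vertical hC.le hG' hK hu'
    have h2 : ‖L - K (u.re : ℂ)‖ ≤ C / b * Real.exp (-b * u.re) := by
      refine le_of_tendsto ((hL.sub_const _).norm) ?_
      filter_upwards [eventually_ge_atTop u.re] with s hs
      exact hreal2 _ _ hu'.1 (hs.trans (le_max_left _ _))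
    rw [norm_sub_rev] at h2
    have h4 : ‖K u - L‖ ≤ _ := (norm_sub_le_norm_sub_add_norm_sub _ (K (u.re : ℂ)) _).trans
      (add_le_add h1 h2)
    linarith

lemma ExpDecay.exists_scalar_solution [CompleteSpace E] {θ a : ℝ} (hθ : 0 < θ) {β : ℂ}
    (hβ : a + β.re ≠ 0) {g : ℂ → E} (hg : ExpDecay θ a g) :
    ∃ k, ExpDecay θ a k ∧ ∀ᶠ u in stripEnd θ, HasDerivAt k (β • k u + g u) u := by
  obtain ⟨K, hK, hd⟩ := (hg.exp_smul β).exists_primitive hθ hβ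
  refine ⟨fun u => exp (-(-β) * u) • K u, by simpa using hK.exp_smul (-β), ?_⟩
  filter_upwards [hd] with u hu
  have h1 : HasDerivAt (fun u => exp (-(-β) * u)) (exp (-(-β) * u) * (-(-β) * 1)) u :=
    ((hasDerivAt_id u).const_mul (-(-β))).cexp
  refine (h1.smul hu).congr_deriv ?_
  rw [smul_smul, smul_smul, ← exp_add, add_comm]
  simp [mul_comm]

open Polynomial in
/-- The constant-coefficient linear equation `δ' = B δ + g` can be solved without loss in the
exponential rate, as long as the rate is not opposite to the real part of an eigenvalue. -/
lemma ExpDecay.exists_solution [CompleteSpace E] [FiniteDimensional ℂ (E →L[ℂ] E)] {θ a : ℝ}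
    (hθ : 0 < θ) (B : E →L[ℂ] E) (hB : ∀ β ∈ (minpoly ℂ B).roots, a + β.re ≠ 0) {g : ℂ → E}
    (hg : ExpDecay θ a g) :
    ∃ δ, ExpDecay θ a δ ∧ ∀ᶠ u in stripEnd θ, HasDerivAt δ (B (δ u) + g u) u := by
  have key : ∀ s : Multiset ℂ, (∀ β ∈ s, a + β.re ≠ 0) → ∃ δ h : ℂ → E, ExpDecay θ a δ ∧
      ExpDecay θ a h ∧ ∀ᶠ u in stripEnd θ, HasDerivAt δ
        (B (δ u) + g u - aeval B (s.map fun β => X - C β).prod (h u)) u := by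
    intro s
    induction s using Multiset.induction_on with
    | empty =>
      intro _
      refine ⟨fun _ => 0, g, ?_, hg, ?_⟩
      · exact ⟨by simp, by simpa using isBigO_zero _ _⟩
      · refine Eventually.of_forall fun u => ?_
        simpa using hasDerivAt_const u (0 : E)
    | cons β s ih =>
      intro hs
      obtain ⟨δ, h, hδ, hh, hd⟩ := ih fun γ hγ => hs γ (Multiset.mem_cons_of_mem hγ)
      obtain ⟨k, hk, hkd⟩ := hh.exists_scalar_solution hθ (hs β (Multiset.mem_cons_self β s))
      set T := aeval B (s.map fun β => X - C β).prod with hT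
      refine ⟨fun u => δ u + T (k u), k, hδ.add (hk.clm T), hk, ?_⟩
      filter_upwards [hd, hkd] with u h1 h2
      refine (h1.add (T.hasFDerivAt.comp_hasDerivAt u h2)).congr_deriv ?_
      rw [Multiset.map_cons, Multiset.prod_cons, map_mul, ← hT]
      have hcomm : B (T (k u)) = T (B (k u)) := by
        have : B * T = T * B := by
          rw [hT]
          have h3 := (Commute.all (X : ℂ[X]) (s.map fun β => X - C β).prod).map
            (aeval (R := ℂ) B)
          rw [aeval_X] at h3
          exact h3
        exact congrArg (fun S : E →L[ℂ] E => S (k u)) this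
      simp [hcomm, Algebra.algebraMap_eq_smul_one]
      abel
  obtain ⟨δ, h, hδ, -, hd⟩ := key _ hB
  refine ⟨δ, hδ, ?_⟩
  have hsplit : aeval B ((minpoly ℂ B).roots.map fun β => X - C β).prod = 0 := by
    have h1 := (IsAlgClosed.splits (minpoly ℂ B)).eq_prod_roots_of_monic
      (minpoly.monic (Algebra.IsIntegral.isIntegral B))
    rw [← h1, minpoly.aeval]
  rw [hsplit] at hd
  simpa using hd

/-- Rescaled first-order estimates for a map `H` whose leading part is the homogeneous map `P`. -/
lemma exists_rescaled_bound {m : ℕ} {H P : E → E}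
    (hH : ∀ᶠ z in 𝓝 0, DifferentiableAt ℂ H z) (hP : ContDiff ℂ 2 P)
    (hhom : ∀ (s : ℂ) y, P (s • y) = s ^ (m + 1) • P y)
    (hHP : (fun z => H z - P z) =O[𝓝 0] fun z => ‖z‖ ^ (m + 2)) (y₀ : E) :
    ∃ C > 0, ∃ ρ > 0, ∀ s : ℂ, ‖s‖ < ρ →
      ‖H (s • y₀) - s ^ (m + 1) • P y₀‖ ≤ C * ‖s‖ ^ (m + 2) ∧
      (∀ y ∈ closedBall y₀ ρ, DifferentiableAt ℂ H (s • y)) ∧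
      ∀ η ≤ ρ, ∀ y₁ ∈ closedBall y₀ η, ∀ y₂ ∈ closedBall y₀ η,
        ‖H (s • y₁) - H (s • y₂) - s ^ (m + 1) • fderiv ℂ P y₀ (y₁ - y₂)‖
          ≤ C * ‖s‖ ^ (m + 1) * (η + ‖s‖) * ‖y₁ - y₂‖ := by
  obtain ⟨K, hK, hKb⟩ := hHP.exists_pos
  obtain ⟨r, hr, hball⟩ := Metric.eventually_nhds_iff_ball.1 (hH.and hKb.bound)
  have hP1 : ContDiff ℂ 1 (fderiv ℂ P) := hP.fderiv_right (by norm_num)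
  obtain ⟨L, V, hV, hL⟩ := (hP1.contDiffAt (x := y₀)).exists_lipschitzOnWith
  obtain ⟨η₀, hη₀, hη₀V⟩ := Metric.nhds_basis_closedBall.mem_iff.1 hV
  have hdP : Differentiable ℂ P := hP.differentiable (by norm_num)
  set M := ‖y₀‖ + 2 with hM
  have hM0 : 0 < M := by positivity
  have hmem : ∀ s : ℂ, ‖s‖ < r / M → ∀ y ∈ ball y₀ 2, s • y ∈ ball (0 : E) r ∧ ‖y‖ ≤ M := by
    intro s hs y hy
    have h1 : ‖y‖ ≤ M := by
      rw [mem_ball, dist_eq_norm] at hy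
      have := norm_sub_norm_le y y₀
      linarith
    refine ⟨?_, h1⟩
    rw [mem_ball_zero_iff, norm_smul]
    rw [lt_div_iff₀ hM0] at hs
    exact lt_of_le_of_lt (by gcongr) hs
  have hG : ∀ s : ℂ, ‖s‖ < r / M → ∀ y ∈ ball y₀ 2,
      ‖H (s • y) - s ^ (m + 1) • P y‖ ≤ K * M ^ (m + 2) * ‖s‖ ^ (m + 2) := by
    intro s hs y hy
    obtain ⟨h1, h2⟩ := hmem s hs y hy
    have h3 := (hball _ h1).2
    rw [hhom, norm_pow, norm_norm, norm_smul] at h3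
    refine h3.trans ?_
    calc K * (‖s‖ * ‖y‖) ^ (m + 2) ≤ K * (‖s‖ * M) ^ (m + 2) := by gcongr
      _ = K * M ^ (m + 2) * ‖s‖ ^ (m + 2) := by rw [mul_pow]; ring
  have hGd : ∀ s : ℂ, ‖s‖ < r / M → ∀ y ∈ ball y₀ 2,
      DifferentiableAt ℂ (fun y => H (s • y) - s ^ (m + 1) • P y) y := by
    intro s hs y hy
    have h1 : DifferentiableAt ℂ H (s • y) := (hball _ (hmem s hs y hy).1).1
    exact (DifferentiableAt.comp (f := fun y => s • y) y h1 (by fun_prop)).sub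
      ((hdP y).const_smul _)
  set C₁ := K * M ^ (m + 2) with hC₁
  have hC₁0 : 0 < C₁ := by positivity
  have hGf : ∀ s : ℂ, ‖s‖ < r / M → ∀ y ∈ closedBall y₀ (1 / 2),
      ‖fderiv ℂ (fun y => H (s • y) - s ^ (m + 1) • P y) y‖ ≤ 2 * C₁ * ‖s‖ ^ (m + 2) := by
    intro s hs y hy
    have hsub : ball y 1 ⊆ ball y₀ 2 := by
      refine ball_subset_ball' ?_
      rw [mem_closedBall] at hy
      linarith
    rw [← div_one (2 * C₁ * _)]
    refine norm_fderiv_le_div_of_mapsTo_ball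
      (fun w hw => (hGd s hs w (hsub hw)).differentiableWithinAt) (fun w hw => ?_) one_pos
    rw [mem_closedBall, dist_eq_norm]
    refine (norm_sub_le _ _).trans ?_
    have := hG s hs w (hsub hw)
    have := hG s hs y (hsub (mem_ball_self one_pos))
    linarith
  refine ⟨2 * C₁ + L, by positivity, min (r / M) (min η₀ (1 / 2)), by positivity, ?_⟩
  intro s hs
  have hs1 : ‖s‖ < r / M := hs.trans_le (min_le_left _ _)
  refine ⟨?_, ?_, ?_⟩
  · refine (hG s hs1 y₀ (mem_ball_self two_pos)).trans ?_
    gcongr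
    have := L.2
    linarith [NNReal.coe_nonneg L]
  · intro y hy
    refine (hball _ (hmem s hs1 y ?_).1).1
    refine closedBall_subset_ball ?_ hy
    exact lt_of_le_of_lt ((min_le_right _ _).trans (min_le_right _ _)) (by norm_num)
  · intro η hη y₁ hy₁ y₂ hy₂
    have hη1 : η ≤ η₀ := hη.trans ((min_le_right _ _).trans (min_le_left _ _))
    have hη2 : η ≤ 1 / 2 := hη.trans ((min_le_right _ _).trans (min_le_right _ _))
    have hη0 : 0 ≤ η := dist_nonneg.trans hy₁
    have h1 : ‖(H (s • y₁) - s ^ (m + 1) • P y₁) - (H (s • y₂) - s ^ (m + 1) • P y₂)‖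
        ≤ 2 * C₁ * ‖s‖ ^ (m + 2) * ‖y₁ - y₂‖ :=
      (convex_closedBall y₀ η).norm_image_sub_le_of_norm_fderiv_le (𝕜 := ℂ)
        (f := fun y => H (s • y) - s ^ (m + 1) • P y)
        (fun y hy => hGd s hs1 y (closedBall_subset_ball (by linarith) hy))
        (fun y hy => hGf s hs1 y (closedBall_subset_closedBall hη2 hy)) hy₂ hy₁
    have h2 : ‖P y₁ - P y₂ - fderiv ℂ P y₀ (y₁ - y₂)‖ ≤ L * η * ‖y₁ - y₂‖ := by
      refine (convex_closedBall y₀ η).norm_image_sub_le_of_norm_fderiv_le' (𝕜 := ℂ)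
        (fun y hy => hdP y) (fun y hy => ?_) hy₂ hy₁
      have := hL.dist_le_mul y (hη₀V (closedBall_subset_closedBall hη1 hy)) y₀
        (hη₀V (mem_closedBall_self hη₀.le))
      rw [dist_eq_norm] at this
      refine this.trans ?_
      rw [mem_closedBall] at hy
      gcongr
    have h3 : H (s • y₁) - H (s • y₂) - s ^ (m + 1) • fderiv ℂ P y₀ (y₁ - y₂)
        = ((H (s • y₁) - s ^ (m + 1) • P y₁) - (H (s • y₂) - s ^ (m + 1) • P y₂))
          + s ^ (m + 1) • (P y₁ - P y₂ - fderiv ℂ P y₀ (y₁ - y₂)) := by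
      simp only [smul_sub]; abel
    rw [h3]
    refine (norm_add_le _ _).trans ?_
    rw [norm_smul, norm_pow]
    have h4 : ‖s‖ ^ (m + 1) * ‖P y₁ - P y₂ - fderiv ℂ P y₀ (y₁ - y₂)‖
        ≤ ‖s‖ ^ (m + 1) * (L * η * ‖y₁ - y₂‖) := by gcongr
    refine (add_le_add h1 h4).trans ?_
    have h5 : 0 ≤ 2 * C₁ * ‖s‖ ^ (m + 1) * η * ‖y₁ - y₂‖ := by positivity
    have h6 : 0 ≤ L * ‖s‖ ^ (m + 1) * ‖s‖ * ‖y₁ - y₂‖ := by positivity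
    have h7 : ‖s‖ ^ (m + 2) = ‖s‖ ^ (m + 1) * ‖s‖ := pow_succ _ _
    rw [h7]
    linarith

/-- The leading term `t^{-σ} y₀`, as a function of `u = log t`. -/
noncomputable def leading (σ : ℝ) (y₀ : E) (u : ℂ) : E := exp (-(σ : ℂ) * u) • y₀

/-- The defect of the equation `f (φ t) = φ (t + 1)`, where `f = id + H` and `u = log t`. -/
noncomputable def defect (H : E → E) (φ : ℂ → E) (u : ℂ) : E :=
  φ (u + logStep u) - φ u - H (φ u)

lemma hasDerivAt_leading (σ : ℝ) (y₀ : E) (u : ℂ) :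
    HasDerivAt (leading σ y₀) (-(σ : ℂ) • leading σ y₀ u) u := by
  have h1 : HasDerivAt (fun u => exp (-(σ : ℂ) * u)) (exp (-(σ : ℂ) * u) * (-(σ : ℂ) * 1)) u :=
    ((hasDerivAt_id u).const_mul (-(σ : ℂ))).cexp
  refine (h1.smul_const y₀).congr_deriv ?_
  rw [leading, smul_smul, mul_one, mul_comm]

lemma expDecay_leading (θ σ : ℝ) (y₀ : E) : ExpDecay θ σ (leading σ y₀) := by
  have h := (expDecay_const θ y₀).exp_smul (σ : ℂ)
  rw [zero_add, ofReal_re] at h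
  exact h

lemma norm_exp_real_mul (σ : ℝ) (u : ℂ) : ‖exp (-(σ : ℂ) * u)‖ = Real.exp (-σ * u.re) := by
  rw [norm_exp]; simp

lemma exp_pow_succ {m : ℕ} {σ : ℝ} (hσ : m * σ = 1) (u : ℂ) :
    exp (-(σ : ℂ) * u) ^ (m + 1) = exp (-u) * exp (-(σ : ℂ) * u) := by
  have h : (m : ℂ) * σ = 1 := by exact_mod_cast hσ
  rw [pow_succ, ← exp_nat_mul]
  congr 2
  linear_combination -u * h

lemma leading_add_eq (σ : ℝ) (y₀ x : E) (u : ℂ) :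
    leading σ y₀ u + x = exp (-(σ : ℂ) * u) • (y₀ + exp (σ * u) • x) := by
  rw [leading, smul_add, smul_smul, ← exp_add]
  simp

/-- Near the right end of a strip, a perturbation of the leading term stays in the domain of the
rescaled estimates. -/
lemma ExpDecay.eventually_rescaled {θ σ : ℝ} {δ : ℂ → E}
    (hδ : ExpDecay θ (3 * σ / 2) δ) :
    ∃ D > 0, ∀ᶠ u in stripEnd θ, ‖exp ((σ : ℂ) * u) • δ u‖ ≤ D * Real.exp (-(σ / 2) * u.re) := by
  obtain ⟨D, hD, hb⟩ := (hδ.exp_smul (-(σ : ℂ))).2.exists_pos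
  refine ⟨D, hD, ?_⟩
  filter_upwards [hb.bound] with u hu
  rw [Real.norm_of_nonneg (Real.exp_pos _).le] at hu
  rw [neg_neg] at hu
  refine hu.trans (le_of_eq ?_)
  congr 3
  simp only [neg_re, ofReal_re]
  ring

lemma eventually_differentiableAt_leading_add {H : E → E}
    (hH : ∀ᶠ z in 𝓝 0, DifferentiableAt ℂ H z) {θ σ : ℝ} (hσ : 0 < σ) {y₀ : E} {δ : ℂ → E}
    (hδ : ExpDecay θ (3 * σ / 2) δ) :
    ∀ᶠ u in stripEnd θ, DifferentiableAt ℂ H (leading σ y₀ u + δ u) := by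
  have h1 : ExpDecay θ σ (fun u => leading σ y₀ u + δ u) :=
    (expDecay_leading θ σ y₀).add (hδ.mono_rate (by linarith))
  exact (h1.2.trans_tendsto (tendsto_exp_neg_re_stripEnd θ hσ)).eventually hH

section

variable {m : ℕ} {H P : E → E} (hH : ∀ᶠ z in 𝓝 0, DifferentiableAt ℂ H z) (hP : ContDiff ℂ 2 P)
  (hhom : ∀ (s : ℂ) y, P (s • y) = s ^ (m + 1) • P y)
  (hHP : (fun z => H z - P z) =O[𝓝 0] fun z => ‖z‖ ^ (m + 2))
  {σ : ℝ} (hmσ : m * σ = 1) (hσ : 0 < σ) (y₀ : E)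

include hH hP hhom hHP hmσ hσ

lemma isBigO_sub_linear {θ a : ℝ} {δ δ₁ : ℂ → E} (hδ : ExpDecay θ (3 * σ / 2) δ)
    (hδ₁ : ExpDecay θ (3 * σ / 2) δ₁) (hδa : ExpDecay θ a δ₁) :
    (fun u => H (leading σ y₀ u + (δ u + δ₁ u)) - H (leading σ y₀ u + δ u)
        - exp (-u) • fderiv ℂ P y₀ (δ₁ u))
      =O[stripEnd θ] fun u => Real.exp (-(1 + σ / 2 + a) * u.re) := by
  obtain ⟨C, hC, ρ, hρ, hmain⟩ := exists_rescaled_bound hH hP hhom hHP y₀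
  obtain ⟨D₁, hD₁, h1⟩ := hδ.eventually_rescaled
  obtain ⟨D₂, hD₂, h2⟩ := (hδ.add hδ₁).eventually_rescaled
  obtain ⟨D₃, hD₃, h3⟩ := hδa.2.exists_pos
  have hη : ∀ᶠ u in stripEnd θ, (D₁ + D₂) * Real.exp (-(σ / 2) * u.re) < ρ := by
    have := (tendsto_exp_neg_re_stripEnd θ (half_pos hσ)).const_mul (D₁ + D₂)
    rw [mul_zero] at this
    exact this.eventually_lt_const hρ
  refine IsBigO.of_bound (C * (D₁ + D₂ + 1) * D₃) ?_
  filter_upwards [h1, h2, h3.bound, hη,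
    (tendsto_exp_neg_re_stripEnd θ hσ).eventually_lt_const hρ,
    (tendsto_re_stripEnd θ).eventually_ge_atTop 0] with u h1 h2 h3 hη hs hx
  set s := exp (-(σ : ℂ) * u) with hs_def
  have hsn : ‖s‖ = Real.exp (-σ * u.re) := norm_exp_real_mul σ u
  rw [← hsn] at hs
  have e0 : 0 < Real.exp (-(σ / 2) * u.re) := Real.exp_pos _
  have key := (hmain s hs).2.2 _ hη.le (y₀ + exp (σ * u) • (δ u + δ₁ u)) ?_
    (y₀ + exp (σ * u) • δ u) ?_
  · rw [← leading_add_eq, ← leading_add_eq] at key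
    have h4 : (y₀ + exp (σ * u) • (δ u + δ₁ u)) - (y₀ + exp (σ * u) • δ u)
        = exp (σ * u) • δ₁ u := by
      rw [smul_add]; abel
    have h5 : s ^ (m + 1) * exp (σ * u) = exp (-u) := by
      rw [hs_def, exp_pow_succ hmσ, mul_assoc, ← exp_add]
      simp
    rw [h4, map_smul, smul_smul, h5] at key
    refine key.trans ?_
    rw [Real.norm_of_nonneg (Real.exp_pos _).le] at h3 ⊢
    have h6 : ‖exp ((σ : ℂ) * u) • δ₁ u‖ = Real.exp (σ * u.re) * ‖δ₁ u‖ := by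
      rw [norm_smul, norm_exp]; simp
    have h7 : ‖s‖ ^ (m + 1) = Real.exp (-u.re) * Real.exp (-σ * u.re) := by
      rw [← norm_pow, hs_def, exp_pow_succ hmσ, norm_mul, norm_exp_neg, norm_exp_real_mul]
    have h8 : ‖s‖ ≤ Real.exp (-(σ / 2) * u.re) := by
      rw [hsn]
      exact Real.exp_le_exp.2 (by nlinarith)
    rw [h6, h7]
    calc C * (Real.exp (-u.re) * Real.exp (-σ * u.re))
          * ((D₁ + D₂) * Real.exp (-(σ / 2) * u.re) + ‖s‖) * (Real.exp (σ * u.re) * ‖δ₁ u‖)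
        ≤ C * (Real.exp (-u.re) * Real.exp (-σ * u.re))
          * ((D₁ + D₂) * Real.exp (-(σ / 2) * u.re) + Real.exp (-(σ / 2) * u.re))
          * (Real.exp (σ * u.re) * (D₃ * Real.exp (-a * u.re))) := by gcongr
      _ = C * (D₁ + D₂ + 1) * D₃ * (Real.exp (-u.re) * Real.exp (-σ * u.re)
          * Real.exp (-(σ / 2) * u.re) * Real.exp (σ * u.re) * Real.exp (-a * u.re)) := by ring
      _ = _ := by
        simp only [← Real.exp_add]
        congr 2
        ring
  · rw [mem_closedBall, dist_eq_norm, add_sub_cancel_left]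
    refine h2.trans ?_
    gcongr
    linarith
  · rw [mem_closedBall, dist_eq_norm, add_sub_cancel_left]
    refine h1.trans ?_
    gcongr
    linarith

lemma expDecay_defect_leading (hPy : P y₀ = -(σ : ℂ) • y₀) (hσ1 : σ ≤ 1) (θ : ℝ)
    [CompleteSpace E] : ExpDecay θ (1 + 2 * σ) (defect H (leading σ y₀)) := by
  have hT := (expDecay_leading (θ + 1 + 1 + 1) σ y₀).taylor
  have hbd : (fun u => H (leading σ y₀ u) - (exp (-u) * exp (-(σ : ℂ) * u)) • P y₀)
      =O[stripEnd θ] fun u => Real.exp (-(1 + 2 * σ) * u.re) := by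
    obtain ⟨C, hC, ρ, hρ, hmain⟩ := exists_rescaled_bound hH hP hhom hHP y₀
    refine IsBigO.of_bound C ?_
    filter_upwards [(tendsto_exp_neg_re_stripEnd θ hσ).eventually_lt_const hρ] with u hu
    rw [← norm_exp_real_mul] at hu
    have := (hmain _ hu).1
    rw [exp_pow_succ hmσ] at this
    refine this.trans (le_of_eq ?_)
    rw [Real.norm_of_nonneg (Real.exp_pos _).le, pow_succ, ← norm_pow, exp_pow_succ hmσ, norm_mul,
      norm_exp_neg, norm_exp_real_mul, ← Real.exp_add, ← Real.exp_add]
    congr 2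
    ring
  have hdiff : ∀ᶠ u in stripEnd θ, DifferentiableAt ℂ H (leading σ y₀ u) :=
    ((expDecay_leading θ σ y₀).2.trans_tendsto (tendsto_exp_neg_re_stripEnd θ hσ)).eventually hH
  constructor
  · filter_upwards [hdiff, (expDecay_leading (θ + 1) σ y₀).shift.1] with u h1 h2
    have h3 := (hasDerivAt_leading σ y₀ u).differentiableAt
    exact (h2.sub h3).sub (DifferentiableAt.comp u h1 h3)
  · refine ((hT.2.trans (isBigO_exp_rate θ (by linarith))).sub hbd).congr_left fun u => ?_
    have h1 : exp (-u) • (-(σ : ℂ) • leading σ y₀ u)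
        = (exp (-u) * exp (-(σ : ℂ) * u)) • (-(σ : ℂ) • y₀) := by
      rw [leading]
      simp only [smul_smul]
      ring_nf
    rw [defect, (hasDerivAt_leading σ y₀ u).deriv, hPy, h1]
    abel

lemma exists_expDecay_defect (hPy : P y₀ = -(σ : ℂ) • y₀) (hσ1 : σ ≤ 1)
    [CompleteSpace E] [FiniteDimensional ℂ (E →L[ℂ] E)] (k : ℕ) :
    ∀ θ > 0, ∃ δ, ExpDecay θ (3 * σ / 2) δ ∧
      ExpDecay θ (1 + 2 * σ + k * (σ / 4)) (defect H fun u => leading σ y₀ u + δ u) := by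
  induction k with
  | zero =>
    intro θ hθ
    refine ⟨fun _ => 0, ⟨by simp, by simpa using isBigO_zero _ _⟩, ?_⟩
    simpa using expDecay_defect_leading hH hP hhom hHP hmσ hσ y₀ hPy hσ1 θ
  | succ k ih =>
    intro θ hθ
    obtain ⟨δ, hδ, hdef⟩ := ih (θ + 1 + 1 + 1) (by linarith)
    set a := 2 * σ + k * (σ / 4) with ha
    set B := fderiv ℂ P y₀ with hB
    obtain ⟨a', ⟨ha1, ha2⟩, ha3⟩ := ((Ioo_infinite (by linarith : a - σ / 4 < a)).sdiff
      (Finset.finite_toSet ((minpoly ℂ B).roots.map fun β => -β.re).toFinset)).nonempty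
    have hk : 0 ≤ k * (σ / 4) := by positivity
    have ha4 : 3 * σ / 2 ≤ a' := by linarith
    have hg := ((hdef.exp_smul (-1)).neg).mono_rate (a' := a') (by simp; linarith)
    obtain ⟨δ₁, hδ₁, hder⟩ := hg.exists_solution (by linarith) B (fun β hβ h0 => ha3 (by
      simp only [Finset.mem_coe, Multiset.mem_toFinset, Multiset.mem_map]
      exact ⟨β, hβ, by linarith⟩))
    have hδ₁' := hδ₁.mono_rate ha4
    have w1 : θ ≤ θ + 1 + 1 + 1 := by linarith
    have w2 : θ + 1 ≤ θ + 1 + 1 + 1 := by linarith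
    have hsum := hδ.add hδ₁'
    refine ⟨fun u => δ u + δ₁ u, hsum.mono_width w1, ?_, ?_⟩
    · have h0 := ((expDecay_leading (θ + 1) σ y₀).add
        ((hsum.mono_width w2).mono_rate (by linarith : σ ≤ 3 * σ / 2)))
      filter_upwards [eventually_differentiableAt_leading_add (y₀ := y₀) hH hσ
        (hsum.mono_width w1), h0.shift.1, (h0.mono_width (by linarith : θ ≤ θ + 1)).1]
        with u h1 h2 h3
      exact (h2.sub h3).sub
        (DifferentiableAt.comp (f := fun u => leading σ y₀ u + (δ u + δ₁ u)) u h1 h3)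
    · have hT := hδ₁.taylor
      have hL := isBigO_sub_linear hH hP hhom hHP hmσ hσ y₀ (hδ.mono_width w1)
        (hδ₁'.mono_width w1) (hδ₁.mono_width w1)
      have hTL := (hT.2.trans (isBigO_exp_rate θ
        (by push_cast; linarith : 1 + 2 * σ + ((k + 1 : ℕ) : ℝ) * (σ / 4) ≤ a' + 2))).sub
        (hL.trans (isBigO_exp_rate θ
        (by push_cast; linarith : 1 + 2 * σ + ((k + 1 : ℕ) : ℝ) * (σ / 4) ≤ 1 + σ / 2 + a')))
      refine hTL.congr' ?_ EventuallyEq.rfl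
      filter_upwards [hder.filter_mono (stripEnd_mono w1)] with u hu
      have he : exp (-u) * exp u = 1 := by rw [← exp_add]; simp
      rw [hu.deriv, smul_add, smul_neg, smul_smul, neg_neg, one_mul, he, one_smul, defect, defect,
        ← hB]
      abel

end

/-- The right half-plane `Re t > R`. -/
def halfPlane (R : ℝ) : Set ℂ := {t | R < t.re}

lemma isOpen_halfPlane (R : ℝ) : IsOpen (halfPlane R) := isOpen_lt continuous_const continuous_re

lemma add_natCast_mem_halfPlane {R : ℝ} {t : ℂ} (ht : t ∈ halfPlane R) (k : ℕ) :
    t + k ∈ halfPlane R := by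
  have : (0 : ℝ) ≤ k := k.cast_nonneg
  simp only [halfPlane, mem_ofPred_eq, add_re, natCast_re] at ht ⊢
  linarith

lemma add_one_mem_halfPlane {R : ℝ} {t : ℂ} (ht : t ∈ halfPlane R) : t + 1 ∈ halfPlane R := by
  simpa using add_natCast_mem_halfPlane ht 1

section Sums

lemma summable_and_tsum_le_of_le_sub {a b : ℕ → ℝ} (ha : ∀ k, 0 ≤ a k) (hb : ∀ k, 0 ≤ b k)
    (hab : ∀ k, a k ≤ b k - b (k + 1)) : Summable a ∧ ∑' k, a k ≤ b 0 := by
  have h : ∀ n, ∑ k ∈ Finset.range n, a k ≤ b 0 := fun n => by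
    calc ∑ k ∈ Finset.range n, a k ≤ ∑ k ∈ Finset.range n, (b k - b (k + 1)) :=
          Finset.sum_le_sum fun k _ => hab k
      _ = b 0 - b n := Finset.sum_range_sub' b n
      _ ≤ b 0 := sub_le_self _ (hb n)
  exact ⟨summable_of_sum_range_le ha h, Real.tsum_le_of_sum_range_le ha h⟩

lemma summable_and_tsum_inv_add_sq_pow_le {r : ℕ} (hr : 1 ≤ r) {T : ℝ} (hT : 2 * r ≤ T) :
    Summable (fun k : ℕ => ((T ^ 2 + (k : ℝ) ^ 2) ^ r ^ 2)⁻¹) ∧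
      ∑' k : ℕ, ((T ^ 2 + (k : ℝ) ^ 2) ^ r ^ 2)⁻¹ ≤ 4 / r * (T / T ^ (2 * r ^ 2)) := by
  have hr' : (1 : ℝ) ≤ r := by exact_mod_cast hr
  have hT0 : 0 < T := by linarith
  have hTr : 0 < T - r := by linarith
  set c : ℝ := T ^ 2 / T ^ (2 * r ^ 2) with hc
  have hc0 : 0 < c := by positivity
  have hpos : ∀ k : ℕ, 0 < T + r * k - r := fun k => by
    have : 0 ≤ (r : ℝ) * k := by positivity
    linarith
  have key := summable_and_tsum_le_of_le_sub
    (a := fun k : ℕ => ((T ^ 2 + (k : ℝ) ^ 2) ^ r ^ 2)⁻¹)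
    (b := fun k : ℕ => c * (2 / r * (T + r * k - r)⁻¹)) (fun k => by positivity)
    (fun k => by have := hpos k; positivity) (fun k => ?_)
  · refine ⟨key.1, key.2.trans ?_⟩
    have h1 : (T - r)⁻¹ ≤ 2 / T := by
      rw [inv_le_comm₀ hTr (by positivity), inv_div]
      linarith
    calc c * (2 / r * (T + r * ((0 : ℕ) : ℝ) - r)⁻¹) = c * (2 / r * (T - r)⁻¹) := by simp
      _ ≤ c * (2 / r * (2 / T)) := by gcongr
      _ = _ := by rw [hc]; field_simp; norm_num
  · have hk := hpos k
    have hb : 1 + ((r ^ 2 : ℕ) : ℝ) * ((k : ℝ) ^ 2 / T ^ 2) ≤ (1 + (k : ℝ) ^ 2 / T ^ 2) ^ r ^ 2 :=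
      one_add_mul_le_pow (by have : 0 ≤ (k : ℝ) ^ 2 / T ^ 2 := by positivity
                             linarith) _
    have hs : 0 < T + r * k := by linarith
    have h1 : (T + r * k) ^ 2 / (2 * c) ≤ (T ^ 2 + (k : ℝ) ^ 2) ^ r ^ 2 := by
      calc (T + r * k) ^ 2 / (2 * c) ≤ (T ^ 2 + (r * k) ^ 2) / c := by
            rw [div_le_div_iff₀ (by positivity) hc0]
            nlinarith [sq_nonneg (T - r * k)]
        _ = T ^ (2 * r ^ 2) * (1 + ((r ^ 2 : ℕ) : ℝ) * ((k : ℝ) ^ 2 / T ^ 2)) := by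
            rw [hc]; push_cast; field_simp
        _ ≤ T ^ (2 * r ^ 2) * (1 + (k : ℝ) ^ 2 / T ^ 2) ^ r ^ 2 := by gcongr
        _ = (T ^ 2 + (k : ℝ) ^ 2) ^ r ^ 2 := by
            rw [pow_mul, ← mul_pow]; congr 1; field_simp
    calc ((T ^ 2 + (k : ℝ) ^ 2) ^ r ^ 2)⁻¹ ≤ ((T + r * k) ^ 2 / (2 * c))⁻¹ := by
          gcongr
      _ = 2 * c / ((T + r * k) * (T + r * k)) := by rw [inv_div, sq]
      _ ≤ 2 * c / ((T + r * k - r) * (T + r * k)) := by gcongr; linarith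
      _ = _ := by
          have e : T + r * ((k + 1 : ℕ) : ℝ) - r = T + r * k := by push_cast; ring
          rw [e]
          field_simp
          ring

end Sums

lemma sq_norm_add_natCast_ge {t : ℂ} (ht : 0 ≤ t.re) (k : ℕ) :
    ‖t‖ ^ 2 + (k : ℝ) ^ 2 ≤ ‖t + k‖ ^ 2 := by
  rw [← normSq_eq_norm_sq, ← normSq_eq_norm_sq, normSq_apply, normSq_apply]
  simp only [add_re, natCast_re, add_im, natCast_im]
  have : 0 ≤ t.re * k := by positivity
  nlinarith

/-- An approximate solution `φ` of `Φ (t + 1) = Φ t + H (Φ t)` can be corrected to a true one, as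
soon as the error and the Lipschitz constant of `H` along `φ` are summable along
`t, t + 1, t + 2, …`. -/
theorem exists_exact_solution [CompleteSpace E] {H : E → E} {φ : ℂ → E} {R : ℝ} {w g : ℂ → ℝ}
    {u : ℕ → ℝ} (hφ : DifferentiableOn ℂ φ (halfPlane R))
    (hw0 : ∀ t ∈ halfPlane R, 0 ≤ w t) (hw1 : ∀ t ∈ halfPlane R, w t ≤ 1)
    (hu : Summable u) (hgu : ∀ t ∈ halfPlane R, ∀ k : ℕ, g (t + k) ≤ u k)
    (hg0 : ∀ t ∈ halfPlane R, 0 ≤ g t)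
    (hgw : ∀ t ∈ halfPlane R, ∑' k : ℕ, g (t + k) ≤ w t / 2)
    (hH : ∀ t ∈ halfPlane R, ∀ x, ‖x‖ ≤ w t → DifferentiableAt ℂ H (φ t + x))
    (hL : ∀ t ∈ halfPlane R, ∀ x y, ‖x‖ ≤ w t → ‖y‖ ≤ w t → ∀ M, ‖x - y‖ ≤ M * w t →
      ‖H (φ t + x) - H (φ t + y)‖ ≤ M * g t)
    (hε : ∀ t ∈ halfPlane R, ‖φ (t + 1) - φ t - H (φ t)‖ ≤ g t) :
    ∃ Φ : ℂ → E, DifferentiableOn ℂ Φ (halfPlane R) ∧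
      (∀ t ∈ halfPlane R, ‖Φ t - φ t‖ ≤ w t) ∧
      ∀ t ∈ halfPlane R, Φ (t + 1) = Φ t + H (Φ t) := by
  set G : (ℂ → E) → ℂ → E := fun δ t => H (φ t + δ t) - (φ (t + 1) - φ t) with hG
  set T : (ℂ → E) → ℂ → E := fun δ t => -∑' k : ℕ, G δ (t + k) with hT
  set S : Set (ℂ → E) := {δ | DifferentiableOn ℂ δ (halfPlane R) ∧
    ∀ t ∈ halfPlane R, ‖δ t‖ ≤ w t} with hS
  have hgs : ∀ t ∈ halfPlane R, Summable fun k : ℕ => g (t + k) := fun t ht =>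
    hu.of_nonneg_of_le (fun k => hg0 _ (add_natCast_mem_halfPlane ht k)) (hgu t ht)
  have hGb : ∀ δ ∈ S, ∀ t ∈ halfPlane R, ‖G δ t‖ ≤ 2 * g t := fun δ hδ t ht => by
    have h1 := hL t ht (δ t) 0 (hδ.2 t ht) (by simpa using hw0 t ht) 1
      (by simpa using hδ.2 t ht)
    rw [add_zero] at h1
    have h2 : G δ t = (H (φ t + δ t) - H (φ t)) - (φ (t + 1) - φ t - H (φ t)) := by
      simp only [hG]; abel
    rw [h2]
    refine (norm_sub_le _ _).trans ?_
    linarith [hε t ht]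
  have hGs : ∀ δ ∈ S, ∀ t ∈ halfPlane R, Summable fun k : ℕ => G δ (t + k) :=
    fun δ hδ t ht => ((hgs t ht).mul_left 2).of_norm_bounded
      fun k => hGb δ hδ _ (add_natCast_mem_halfPlane ht k)
  have hGd : ∀ δ ∈ S, DifferentiableOn ℂ (G δ) (halfPlane R) := fun δ hδ t ht => by
    have h1 : DifferentiableAt ℂ φ t := hφ.differentiableAt ((isOpen_halfPlane R).mem_nhds ht)
    have h2 : DifferentiableAt ℂ (fun t => φ (t + 1)) t :=
      DifferentiableAt.comp (f := fun t : ℂ => t + 1) t (hφ.differentiableAt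
        ((isOpen_halfPlane R).mem_nhds (add_one_mem_halfPlane ht))) (by fun_prop)
    have h3 : DifferentiableAt ℂ δ t := hδ.1.differentiableAt ((isOpen_halfPlane R).mem_nhds ht)
    exact ((DifferentiableAt.comp (f := fun t => φ t + δ t) t (hH t ht _ (hδ.2 t ht))
      (h1.add h3)).sub (h2.sub h1)).differentiableWithinAt
  have hTS : ∀ δ ∈ S, T δ ∈ S := fun δ hδ => by
    refine ⟨DifferentiableOn.neg ?_, fun t ht => ?_⟩
    · refine differentiableOn_tsum_of_summable_norm (hu.mul_left 2) (fun k => ?_)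
        (isOpen_halfPlane R) fun k t ht => ?_
      · exact (hGd δ hδ).comp (g := G δ) (f := fun t : ℂ => t + k) (by fun_prop)
          fun t ht => add_natCast_mem_halfPlane ht k
      · have := hGb δ hδ _ (add_natCast_mem_halfPlane ht k)
        linarith [hgu t ht k]
    · rw [hT, norm_neg]
      refine (tsum_of_norm_bounded ((hgs t ht).mul_left 2).hasSum
        fun k => hGb δ hδ _ (add_natCast_mem_halfPlane ht k)).trans ?_
      rw [tsum_mul_left]
      linarith [hgw t ht]
  have hTL : ∀ δ ∈ S, ∀ δ' ∈ S, ∀ M, (∀ t ∈ halfPlane R, ‖δ t - δ' t‖ ≤ M * w t) → 0 ≤ M →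
      ∀ t ∈ halfPlane R, ‖T δ t - T δ' t‖ ≤ M / 2 * w t := fun δ hδ δ' hδ' M hM hM0 t ht => by
    have h1 : T δ t - T δ' t = -∑' k : ℕ, (G δ (t + k) - G δ' (t + k)) := by
      rw [(hGs δ hδ t ht).tsum_sub (hGs δ' hδ' t ht)]
      simp only [hT]
      abel
    rw [h1, norm_neg]
    refine (tsum_of_norm_bounded ((hgs t ht).mul_left M).hasSum fun k => ?_).trans ?_
    · have hk := add_natCast_mem_halfPlane ht k
      simp only [hG, sub_sub_sub_cancel_right]
      exact hL _ hk _ _ (hδ.2 _ hk) (hδ'.2 _ hk) M (hM _ hk)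
    · rw [tsum_mul_left]
      nlinarith [hgw t ht]
  have hTstep : ∀ δ ∈ S, ∀ t ∈ halfPlane R, T δ (t + 1) = T δ t + G δ t := fun δ hδ t ht => by
    have h1 := (hGs δ hδ t ht).tsum_eq_zero_add
    simp only [hT]
    rw [h1]
    have h2 : ∀ k : ℕ, t + 1 + (k : ℂ) = t + ((k + 1 : ℕ) : ℂ) := fun k => by push_cast; ring
    simp only [h2, Nat.cast_zero, add_zero]
    abel
  set d : ℕ → ℂ → E := fun n => T^[n] 0 with hd
  have hd0 : d 0 ∈ S := ⟨by simp [hd], by simpa [hd] using hw0⟩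
  have hdsucc : ∀ n, d (n + 1) = T (d n) := fun n => Function.iterate_succ_apply' T n 0
  have hdS : ∀ n, d n ∈ S := fun n => by
    induction n with
    | zero => exact hd0
    | succ n ih => rw [hdsucc]; exact hTS _ ih
  have hdiff : ∀ n, ∀ t ∈ halfPlane R, ‖d (n + 1) t - d n t‖ ≤ (1 / 2) ^ n * w t := fun n => by
    induction n with
    | zero =>
      intro t ht
      simpa [hd] using (hdS 1).2 t ht
    | succ n ih =>
      intro t ht
      rw [hdsucc (n + 1), hdsucc n]
      have := hTL _ (hdS (n + 1)) _ (hdS n) _ ih (by positivity) t ht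
      rw [hdsucc n] at this
      refine this.trans (le_of_eq ?_)
      ring
  have hdist : ∀ t ∈ halfPlane R, ∀ n, dist (d n t) (d (n + 1) t) ≤ 1 * (1 / 2) ^ n :=
    fun t ht n => by
      rw [dist_comm, dist_eq_norm, one_mul]
      exact (hdiff n t ht).trans (mul_le_of_le_one_right (by positivity) (hw1 t ht))
  have hlim : ∀ t, ∃ x, t ∈ halfPlane R → Tendsto (fun n => d n t) atTop (𝓝 x) := fun t => by
    by_cases ht : t ∈ halfPlane R
    · obtain ⟨x, hx⟩ := cauchySeq_tendsto_of_complete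
        (cauchySeq_of_le_geometric _ _ (by norm_num) (hdist t ht))
      exact ⟨x, fun _ => hx⟩
    · exact ⟨0, fun h => absurd h ht⟩
  choose δ hδ using hlim
  have hunif : TendstoUniformlyOn d δ atTop (halfPlane R) := by
    rw [Metric.tendstoUniformlyOn_iff]
    intro ε hε
    have h1 : Tendsto (fun n : ℕ => 1 * (1 / 2 : ℝ) ^ n / (1 - 1 / 2)) atTop (𝓝 0) := by
      have := (tendsto_pow_atTop_nhds_zero_of_lt_one (r := (1 / 2 : ℝ)) (by norm_num)
        (by norm_num)).const_mul 1 |>.div_const (1 - 1 / 2)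
      simpa using this
    filter_upwards [h1.eventually_lt_const hε] with n hn t ht
    rw [dist_comm]
    exact (dist_le_of_le_geometric_of_tendsto _ _ (by norm_num) (hdist t ht) (hδ t ht) n).trans_lt
      hn
  have hδd : DifferentiableOn ℂ δ (halfPlane R) :=
    hunif.tendstoLocallyUniformlyOn.differentiableOn
      (Eventually.of_forall fun n => (hdS n).1) (isOpen_halfPlane R)
  have hδw : ∀ t ∈ halfPlane R, ‖δ t‖ ≤ w t := fun t ht =>
    le_of_tendsto (hδ t ht).norm (Eventually.of_forall fun n => (hdS n).2 t ht)
  refine ⟨fun t => φ t + δ t, hφ.add hδd, fun t ht => by simpa using hδw t ht, fun t ht => ?_⟩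
  have h1 : Tendsto (fun n => d (n + 1) (t + 1)) atTop (𝓝 (δ (t + 1))) :=
    (tendsto_add_atTop_iff_nat 1).2 (hδ _ (add_one_mem_halfPlane ht))
  have h2 : Tendsto (fun n => d (n + 1) t + G (d n) t) atTop (𝓝 (δ t + G δ t)) :=
    ((tendsto_add_atTop_iff_nat 1).2 (hδ _ ht)).add
      ((((hH t ht _ (hδw t ht)).continuousAt.tendsto.comp ((hδ t ht).const_add _))).sub_const _)
  have h3 : δ (t + 1) = δ t + G δ t := tendsto_nhds_unique h1 (h2.congr fun n => by
    rw [hdsucc n, hTstep _ (hdS n) t ht])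
  simp only [h3, hG]
  abel

/-- The filter of neighbourhoods of `∞` in the half-plane `Re t > R`. -/
noncomputable def halfEnd (R : ℝ) : Filter ℂ := comap norm atTop ⊓ 𝓟 (halfPlane R)

lemma eventually_mem_halfEnd (R : ℝ) : ∀ᶠ t in halfEnd R, t ∈ halfPlane R :=
  mem_inf_of_right (mem_principal_self _)

lemma tendsto_norm_halfEnd (R : ℝ) : Tendsto (norm : ℂ → ℝ) (halfEnd R) atTop :=
  tendsto_comap.mono_left inf_le_left

lemma halfEnd_mono {R R' : ℝ} (h : R ≤ R') : halfEnd R' ≤ halfEnd R :=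
  inf_le_inf_left _ (principal_mono.2 fun _ ht => h.trans_lt ht)

lemma forall_halfPlane_of_eventually {R : ℝ} {p : ℂ → Prop} (h : ∀ᶠ t in halfEnd R, p t) :
    ∀ᶠ S in atTop, ∀ t ∈ halfPlane S, p t := by
  have hb := ((atTop_basis_Ioi (α := ℝ)).comap (norm : ℂ → ℝ)).inf_principal (halfPlane R)
  obtain ⟨S, -, hS⟩ := hb.eventually_iff.1 h
  filter_upwards [eventually_ge_atTop S, eventually_ge_atTop R] with S' h1 h2 t ht
  exact hS ⟨h1.trans_lt (ht.trans_le (re_le_norm t)), h2.trans_lt ht⟩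

lemma tendsto_log_halfEnd : Tendsto log (halfEnd 0) (stripEnd 2) := by
  rw [stripEnd, tendsto_inf, tendsto_comap_iff, tendsto_principal]
  constructor
  · exact (Real.tendsto_log_atTop.comp (tendsto_norm_halfEnd 0)).congr fun t => (log_re t).symm
  · filter_upwards [eventually_mem_halfEnd 0] with t ht
    have h1 : |t.arg| < Real.pi / 2 := abs_arg_lt_pi_div_two_iff.2 (Or.inl ht)
    simp only [log_im]
    linarith [Real.pi_lt_four]

lemma log_add_one {t : ℂ} (ht : 0 < t.re) : log (t + 1) = log t + logStep (log t) := by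
  have h0 : t ≠ 0 := fun h => by simp [h] at ht
  have h1 : 0 < (1 + t⁻¹).re := by
    have : 0 ≤ (t⁻¹).re := by rw [inv_re]; exact div_nonneg ht.le (normSq_nonneg t)
    simp only [add_re, one_re]
    linarith
  have h2 : 1 + t⁻¹ ≠ 0 := fun h => by simp [h] at h1
  have a1 := abs_lt.1 ((abs_arg_lt_pi_div_two_iff (z := t)).2 (Or.inl ht))
  have a2 := abs_lt.1 ((abs_arg_lt_pi_div_two_iff (z := 1 + t⁻¹)).2 (Or.inl h1))
  rw [logStep, exp_neg, exp_log h0, ← log_mul h0 h2 ⟨by linarith, by linarith⟩, mul_add,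
    mul_inv_cancel₀ h0, mul_one]

lemma norm_exp_mul_log (σ : ℝ) {t : ℂ} (ht : 0 < ‖t‖) : ‖exp ((σ : ℂ) * log t)‖ = ‖t‖ ^ σ := by
  rw [norm_exp, Real.rpow_def_of_pos ht]
  simp [mul_comm, log_re]

section

variable {m : ℕ} {H P : E → E} (hH : ∀ᶠ z in 𝓝 0, DifferentiableAt ℂ H z) (hP : ContDiff ℂ 2 P)
  (hhom : ∀ (s : ℂ) y, P (s • y) = s ^ (m + 1) • P y)
  (hHP : (fun z => H z - P z) =O[𝓝 0] fun z => ‖z‖ ^ (m + 2))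
  {σ : ℝ} (hmσ : m * σ = 1) (hσ : 0 < σ) (y₀ : E)

include hH hP hhom hHP hmσ hσ

/-- Near the leading term, `H` is holomorphic and `O(1 / |t|)`-Lipschitz, `u = log t`. -/
lemma exists_lipschitz_near_leading : ∃ L > 0, ∃ ρ > 0, ∀ᶠ u in stripEnd 2,
    ∀ x, ‖exp ((σ : ℂ) * u) • x‖ ≤ ρ → DifferentiableAt ℂ H (leading σ y₀ u + x) ∧
      ∀ y, ‖exp ((σ : ℂ) * u) • y‖ ≤ ρ →
        ‖H (leading σ y₀ u + x) - H (leading σ y₀ u + y)‖ ≤ L * Real.exp (-u.re) * ‖x - y‖ := by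
  obtain ⟨C, hC, ρ, hρ, hmain⟩ := exists_rescaled_bound hH hP hhom hHP y₀
  refine ⟨‖fderiv ℂ P y₀‖ + C * (ρ + ρ), by positivity, ρ, hρ, ?_⟩
  filter_upwards [(tendsto_exp_neg_re_stripEnd 2 hσ).eventually_lt_const hρ] with u hu x hx
  rw [← norm_exp_real_mul] at hu
  set s := exp (-(σ : ℂ) * u) with hs_def
  have hmem : ∀ x, ‖exp ((σ : ℂ) * u) • x‖ ≤ ρ → y₀ + exp ((σ : ℂ) * u) • x ∈ closedBall y₀ ρ :=
    fun x hx => by rwa [mem_closedBall, dist_eq_norm, add_sub_cancel_left]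
  refine ⟨?_, fun y hy => ?_⟩
  · rw [leading_add_eq]
    exact (hmain s hu).2.1 _ (hmem x hx)
  · have key := (hmain s hu).2.2 ρ le_rfl _ (hmem x hx) _ (hmem y hy)
    rw [← leading_add_eq, ← leading_add_eq, add_sub_add_left_eq_sub, ← smul_sub] at key
    have h1 := norm_sub_norm_le (H (leading σ y₀ u + x) - H (leading σ y₀ u + y))
      (s ^ (m + 1) • fderiv ℂ P y₀ (exp ((σ : ℂ) * u) • (x - y)))
    have h2 : ‖s ^ (m + 1) • fderiv ℂ P y₀ (exp ((σ : ℂ) * u) • (x - y))‖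
        ≤ ‖s‖ ^ (m + 1) * (‖fderiv ℂ P y₀‖ * ‖exp ((σ : ℂ) * u) • (x - y)‖) := by
      rw [norm_smul, norm_pow]
      gcongr
      exact ContinuousLinearMap.le_opNorm _ _
    have h3 : ‖s‖ ^ (m + 1) * ‖exp ((σ : ℂ) * u) • (x - y)‖ = Real.exp (-u.re) * ‖x - y‖ := by
      rw [norm_smul, ← norm_pow, ← mul_assoc, ← norm_mul, hs_def, exp_pow_succ hmσ, mul_assoc,
        ← exp_add]
      simp [norm_exp]
    have h4 : C * ‖s‖ ^ (m + 1) * (ρ + ‖s‖) * ‖exp ((σ : ℂ) * u) • (x - y)‖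
        ≤ C * ‖s‖ ^ (m + 1) * (ρ + ρ) * ‖exp ((σ : ℂ) * u) • (x - y)‖ := by
      gcongr
    calc _ ≤ ‖s‖ ^ (m + 1) * (‖fderiv ℂ P y₀‖ * ‖exp ((σ : ℂ) * u) • (x - y)‖)
          + C * ‖s‖ ^ (m + 1) * (ρ + ρ) * ‖exp ((σ : ℂ) * u) • (x - y)‖ := by linarith
      _ = (‖fderiv ℂ P y₀‖ + C * (ρ + ρ)) *
          (‖s‖ ^ (m + 1) * ‖exp ((σ : ℂ) * u) • (x - y)‖) := by ring
      _ = _ := by rw [h3]; ring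

/-- Existence of a holomorphic solution of `Φ (t + 1) = Φ t + H (Φ t)` on a half-plane, with
`Φ t ~ t ^ (-σ) y₀`. -/
theorem exists_holomorphic_solution (hPy : P y₀ = -(σ : ℂ) • y₀) (hσ1 : σ ≤ 1)
    [CompleteSpace E] [FiniteDimensional ℂ (E →L[ℂ] E)] :
    ∃ Φ : ℂ → E, ∀ᶠ R in atTop, DifferentiableOn ℂ Φ (halfPlane R) ∧
      (∀ t ∈ halfPlane R, Φ (t + 1) = Φ t + H (Φ t)) ∧
      Tendsto (fun t => exp ((σ : ℂ) * log t) • Φ t) (halfEnd R) (𝓝 y₀) := by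
  obtain ⟨L, hL, ρ, hρ, hLip⟩ := exists_lipschitz_near_leading hH hP hhom hHP hmσ hσ y₀
  obtain ⟨r, hr⟩ := exists_nat_ge (8 * L + 2)
  have hr2 : (2 : ℝ) ≤ r := by linarith
  have hr1 : 1 ≤ r := by
    have : (1 : ℝ) ≤ r := by linarith
    exact_mod_cast this
  set q := r ^ 2 with hq
  have hq2 : 2 ≤ q := by
    have : 2 ≤ r := by exact_mod_cast hr2
    nlinarith
  obtain ⟨k, hk⟩ := exists_nat_ge ((2 * q : ℝ) / (σ / 4))
  rw [div_le_iff₀ (by positivity)] at hk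
  obtain ⟨δ, hδ, hdef⟩ := exists_expDecay_defect hH hP hhom hHP hmσ hσ y₀ hPy hσ1 k 2 two_pos
  obtain ⟨D, hD, hδb⟩ := hδ.eventually_rescaled
  obtain ⟨C, hC, hCb⟩ := (hdef.mono_rate (by linarith : (2 * q + 1 : ℝ) ≤ _)).2.exists_pos
  have hφd := ((expDecay_leading 2 σ y₀).add
    (hδ.mono_rate (by linarith : σ ≤ 3 * σ / 2))).1
  have hDρ : ∀ᶠ u in stripEnd 2, D * Real.exp (-(σ / 2) * u.re) < ρ / 2 := by
    have := (tendsto_exp_neg_re_stripEnd 2 (half_pos hσ)).const_mul D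
    rw [mul_zero] at this
    exact this.eventually_lt_const (half_pos hρ)
  have hev := forall_halfPlane_of_eventually
    ((tendsto_log_halfEnd.eventually (hLip.and (hδb.and (hCb.bound.and (hφd.and hDρ))))).and
      (((tendsto_norm_halfEnd 0).eventually_ge_atTop (C / L)).and
        ((tendsto_norm_halfEnd 0).eventually_ge_atTop (2 / ρ))))
  obtain ⟨R, hR, hR1, hRr⟩ :=
    (hev.and ((eventually_ge_atTop 1).and (eventually_ge_atTop (2 * r : ℝ)))).exists
  have hre : ∀ t ∈ halfPlane R, 0 < t.re := fun t ht => by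
    have : R < t.re := ht
    linarith
  have hnorm : ∀ t ∈ halfPlane R, R ≤ ‖t‖ := fun t ht => (le_of_lt ht).trans (re_le_norm t)
  have hexp : ∀ t ∈ halfPlane R, Real.exp (log t).re = ‖t‖ := fun t ht => by
    rw [log_re, Real.exp_log (by linarith [hnorm t ht])]
  set w : ℂ → ℝ := fun t => ‖t‖ / ‖t‖ ^ (2 * q) with hw
  set g : ℂ → ℝ := fun t => L * (‖t‖ ^ (2 * q))⁻¹ with hg
  have hgle : ∀ t ∈ halfPlane R, ∀ T, 0 < T → T ≤ ‖t‖ → ∀ k : ℕ,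
      g (t + k) ≤ L * ((T ^ 2 + (k : ℝ) ^ 2) ^ q)⁻¹ := fun t ht T hT0 hT k => by
    simp only [hg, pow_mul]
    gcongr
    refine le_trans ?_ (sq_norm_add_natCast_ge (hre t ht).le k)
    gcongr
  have hw1 : ∀ t ∈ halfPlane R, w t ≤ (‖t‖ ^ 3)⁻¹ := fun t ht => by
    have h1 : 1 ≤ ‖t‖ := hR1.trans (hnorm t ht)
    rw [hw, div_le_iff₀ (by positivity), ← div_eq_inv_mul, le_div_iff₀ (by positivity),
      ← pow_succ']
    exact pow_le_pow_right₀ h1 (by omega)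
  have hrx : ∀ t ∈ halfPlane R, ∀ x : E, ‖x‖ ≤ w t →
      ‖exp ((σ : ℂ) * log t) • x‖ ≤ ‖t‖⁻¹ := fun t ht x hx => by
    have h1 : 1 ≤ ‖t‖ := hR1.trans (hnorm t ht)
    rw [norm_smul, norm_exp_mul_log σ (by linarith)]
    calc ‖t‖ ^ σ * ‖x‖ ≤ ‖t‖ ^ (1 : ℝ) * (‖t‖ ^ 3)⁻¹ := by
          gcongr
          exact hx.trans (hw1 t ht)
      _ ≤ ‖t‖⁻¹ := by
          rw [Real.rpow_one, ← div_eq_mul_inv, inv_eq_one_div,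
            div_le_div_iff₀ (by positivity) (by positivity)]
          nlinarith
  have hball : ∀ t ∈ halfPlane R, ∀ x : E, ‖x‖ ≤ w t →
      ‖exp ((σ : ℂ) * log t) • (δ (log t) + x)‖ ≤ ρ := fun t ht x hx => by
    obtain ⟨⟨-, h2, -, -, h3⟩, -, h4⟩ := hR t ht
    have h5 : ‖t‖⁻¹ ≤ ρ / 2 := by
      rw [← inv_div]
      exact inv_anti₀ (by positivity) h4
    rw [smul_add]
    refine (norm_add_le _ _).trans ?_
    linarith [hrx t ht x hx]
  have key : ∃ Φ : ℂ → E, DifferentiableOn ℂ Φ (halfPlane R) ∧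
      (∀ t ∈ halfPlane R, ‖Φ t - (leading σ y₀ (log t) + δ (log t))‖ ≤ w t) ∧
      ∀ t ∈ halfPlane R, Φ (t + 1) = Φ t + H (Φ t) := by
    refine exists_exact_solution (g := g) (u := fun k : ℕ => L * ((R ^ 2 + (k : ℝ) ^ 2) ^ q)⁻¹)
      ?_ ?_ ?_ ?_ ?_ ?_ ?_ ?_ ?_ ?_
    · intro t ht
      exact (DifferentiableAt.comp (f := log) t (hR t ht).1.2.2.2.1
        (differentiableAt_log (Or.inl (hre t ht)))).differentiableWithinAt
    · intro t _
      positivity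
    · intro t ht
      exact (hw1 t ht).trans (inv_le_one_of_one_le₀ (one_le_pow₀ (hR1.trans (hnorm t ht))))
    · exact (summable_and_tsum_inv_add_sq_pow_le hr1 hRr).1.mul_left L
    · exact fun t ht => hgle t ht R (by linarith) (hnorm t ht)
    · intro t _
      positivity
    · intro t ht
      have hT := summable_and_tsum_inv_add_sq_pow_le hr1 (hRr.trans (hnorm t ht))
      have h0 : 0 < ‖t‖ := by linarith [hnorm t ht]
      have h1 := hgle t ht ‖t‖ h0 le_rfl
      calc ∑' k : ℕ, g (t + k) ≤ ∑' k : ℕ, L * ((‖t‖ ^ 2 + (k : ℝ) ^ 2) ^ q)⁻¹ :=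
            ((hT.1.mul_left L).of_nonneg_of_le (fun k => by positivity) h1).tsum_le_tsum h1
              (hT.1.mul_left L)
        _ ≤ L * (4 / r * w t) := by
            rw [tsum_mul_left]
            gcongr
            exact hT.2
        _ = L * 4 / r * w t := by ring
        _ ≤ 1 / 2 * w t := by
            refine mul_le_mul_of_nonneg_right ?_ (by positivity)
            rw [div_le_div_iff₀ (by linarith) two_pos]
            linarith
        _ = w t / 2 := by ring
    · intro t ht x hx
      rw [add_assoc]
      exact ((hR t ht).1.1 _ (hball t ht x hx)).1
    · intro t ht x y hx hy M hM
      have h0 : 0 < ‖t‖ := by linarith [hnorm t ht]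
      have h1 := ((hR t ht).1.1 _ (hball t ht x hx)).2 _ (hball t ht y hy)
      rw [add_assoc, add_assoc]
      refine h1.trans ?_
      rw [Real.exp_neg, hexp t ht, add_sub_add_left_eq_sub]
      calc L * ‖t‖⁻¹ * ‖x - y‖ ≤ L * ‖t‖⁻¹ * (M * w t) := by gcongr
        _ = M * g t := by
          simp only [hw, hg]
          field_simp
    · intro t ht
      have h0 : 0 < ‖t‖ := by linarith [hnorm t ht]
      have h1 := (hR t ht).1.2.2.1
      rw [defect, ← log_add_one (hre t ht), Real.norm_of_nonneg (Real.exp_pos _).le] at h1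
      refine h1.trans ?_
      have h2 : Real.exp (-(2 * q + 1 : ℝ) * (log t).re) = (‖t‖ ^ (2 * q))⁻¹ * ‖t‖⁻¹ := by
        rw [← hexp t ht, ← Real.exp_nat_mul, ← Real.exp_neg, ← Real.exp_neg, ← Real.exp_add]
        congr 1
        push_cast
        ring
      have h3 : C / L ≤ ‖t‖ := (hR t ht).2.1
      rw [div_le_iff₀ hL] at h3
      rw [h2]
      calc C * ((‖t‖ ^ (2 * q))⁻¹ * ‖t‖⁻¹) ≤ (‖t‖ * L) * ((‖t‖ ^ (2 * q))⁻¹ * ‖t‖⁻¹) := by gcongr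
        _ = L * (‖t‖ ^ (2 * q))⁻¹ := by field_simp
  obtain ⟨Φ, hΦd, hΦw, hΦ⟩ := key
  refine ⟨Φ, ?_⟩
  filter_upwards [eventually_ge_atTop R] with R' hR'
  have hmono : halfPlane R' ⊆ halfPlane R := fun t ht => hR'.trans_lt ht
  refine ⟨hΦd.mono hmono, fun t ht => hΦ t (hmono ht), ?_⟩
  have hlim : Tendsto (fun t => D * Real.exp (-(σ / 2) * (log t).re) + ‖t‖⁻¹) (halfEnd 0)
      (𝓝 0) := by
    have h1 := ((tendsto_exp_neg_re_stripEnd 2 (half_pos hσ)).const_mul D).comp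
      tendsto_log_halfEnd
    have h2 := tendsto_inv_atTop_zero.comp (tendsto_norm_halfEnd 0)
    simpa using h1.add h2
  rw [tendsto_iff_norm_sub_tendsto_zero]
  refine squeeze_zero' (Eventually.of_forall fun _ => norm_nonneg _) ?_
    (hlim.mono_left (halfEnd_mono (by linarith : 0 ≤ R')))
  filter_upwards [eventually_mem_halfEnd R'] with t ht'
  have ht := hmono ht'
  have h1 : exp ((σ : ℂ) * log t) • Φ t - y₀ = exp ((σ : ℂ) * log t) • δ (log t)
      + exp ((σ : ℂ) * log t) • (Φ t - (leading σ y₀ (log t) + δ (log t))) := by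
    rw [← smul_add, leading, ← sub_sub, add_sub_cancel, smul_sub, smul_smul, ← exp_add]
    simp
  rw [h1]
  exact (norm_add_le _ _).trans (add_le_add (hR t ht).1.2.1 (hrx t ht _ (hΦw t ht)))

end

lemma apply_add_natCast_eq {α : Type*} {f : α → α} {Φ Ψ : ℂ → α} {R R' : ℝ}
    (hΦ : ∀ t ∈ halfPlane R, f (Φ t) = Φ (t + 1)) (hΨ : ∀ t ∈ halfPlane R', f (Ψ t) = Ψ (t + 1))
    {t t' : ℂ} (ht : t ∈ halfPlane R) (ht' : t' ∈ halfPlane R') (h : Φ t = Ψ t') (k : ℕ) :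
    Φ (t + k) = Ψ (t' + k) := by
  induction k with
  | zero => simpa using h
  | succ k ih =>
    push_cast
    rw [← add_assoc, ← add_assoc, ← hΦ _ (add_natCast_mem_halfPlane ht k),
      ← hΨ _ (add_natCast_mem_halfPlane ht' k), ih]

lemma iterate_eq_add_natCast {α : Type*} {f : α → α} {Φ : ℂ → α} {R : ℝ}
    (hΦ : ∀ t ∈ halfPlane R, f (Φ t) = Φ (t + 1)) {t : ℂ} (ht : t ∈ halfPlane R) (k : ℕ) :
    f^[k] (Φ t) = Φ (t + k) := by
  induction k with
  | zero => simp
  | succ k ih =>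
    rw [Function.iterate_succ_apply', ih, hΦ _ (add_natCast_mem_halfPlane ht k), add_assoc]
    push_cast
    rfl

lemma tendsto_add_natCast_halfEnd {R : ℝ} {t : ℂ} (ht : t ∈ halfPlane R) :
    Tendsto (fun k : ℕ => t + k) atTop (halfEnd R) := by
  rw [halfEnd, tendsto_inf, tendsto_comap_iff, tendsto_principal]
  refine ⟨?_, Eventually.of_forall fun k => add_natCast_mem_halfPlane ht k⟩
  refine tendsto_atTop_mono (fun k => re_le_norm _) ?_
  simp only [add_re, natCast_re]
  exact tendsto_atTop_add_const_left _ _ tendsto_natCast_atTop_atTop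

lemma tendsto_log_add_natCast_sub (t : ℂ) :
    Tendsto (fun k : ℕ => log (t + k) - (Real.log k : ℂ)) atTop (𝓝 0) := by
  have h1 : Tendsto (fun k : ℕ => 1 + t / (k : ℂ)) atTop (𝓝 1) := by
    have := (tendsto_const_div_atTop_nhds_zero_nat t).const_add 1
    rwa [add_zero] at this
  have h2 := (continuousAt_clog (x := 1) (by simp)).tendsto.comp h1
  rw [log_one] at h2
  refine h2.congr' ?_
  filter_upwards [eventually_gt_atTop 0, h1.eventually_ne one_ne_zero] with k hk h0
  have hk' : (k : ℂ) ≠ 0 := by exact_mod_cast hk.ne'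
  have h3 : t + k = ((k : ℝ) : ℂ) * (1 + t / k) := by
    push_cast
    field_simp
    ring
  rw [h3, log_ofReal_mul (by exact_mod_cast hk) h0]
  simp

lemma tendsto_log_add_natCast_stripEnd (t : ℂ) {θ : ℝ} (hθ : 0 < θ) :
    Tendsto (fun k : ℕ => log (t + k)) atTop (stripEnd θ) := by
  have h := tendsto_log_add_natCast_sub t
  rw [stripEnd, tendsto_inf, tendsto_comap_iff, tendsto_principal]
  constructor
  · have h1 := ((continuous_re.tendsto 0).comp h).add_atTop
      (Real.tendsto_log_atTop.comp tendsto_natCast_atTop_atTop)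
    exact h1.congr fun k => by
      simp only [Function.comp_apply, sub_re, ofReal_re, sub_add_cancel]
  · have h1 := ((continuous_im.tendsto 0).comp h).abs
    simp only [Function.comp_apply, sub_im, ofReal_im, sub_zero, zero_im, abs_zero] at h1
    filter_upwards [h1.eventually_lt_const hθ] with k hk using hk

/-- Two solutions with different leading coefficients have disjoint images. -/
lemma disjoint_image_of_leading_ne {f : E → E} {Φ Ψ : ℂ → E} {R R' σ : ℝ} {y y' : E}
    (hΦ : ∀ t ∈ halfPlane R, f (Φ t) = Φ (t + 1)) (hΨ : ∀ t ∈ halfPlane R', f (Ψ t) = Ψ (t + 1))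
    (hΦl : Tendsto (fun t => exp ((σ : ℂ) * log t) • Φ t) (halfEnd R) (𝓝 y))
    (hΨl : Tendsto (fun t => exp ((σ : ℂ) * log t) • Ψ t) (halfEnd R') (𝓝 y')) (hy : y ≠ y') :
    Disjoint (Φ '' halfPlane R) (Ψ '' halfPlane R') := by
  rw [Set.disjoint_left]
  rintro _ ⟨t, ht, rfl⟩ ⟨t', ht', h⟩
  have h1 := hΦl.comp (tendsto_add_natCast_halfEnd ht)
  have h2 := hΨl.comp (tendsto_add_natCast_halfEnd ht')
  have h3 : Tendsto (fun k : ℕ => exp ((σ : ℂ) * (log (t + k) - Real.log k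
      - (log (t' + k) - Real.log k)))) atTop (𝓝 1) := by
    have := (((tendsto_log_add_natCast_sub t).sub (tendsto_log_add_natCast_sub t')).const_mul
      (σ : ℂ)).cexp
    simpa using this
  have h4 := h3.smul h2
  rw [one_smul] at h4
  refine hy (tendsto_nhds_unique h1 (h4.congr fun k => ?_))
  simp only [Function.comp_apply]
  rw [smul_smul, ← exp_add, apply_add_natCast_eq hΦ hΨ ht ht' h.symm k]
  congr 2
  ring

lemma tendsto_exp_halfEnd (R : ℝ) : Tendsto exp (stripEnd (3 / 2)) (halfEnd R) := by
  have h1 : Tendsto (fun u : ℂ => Real.exp u.re) (stripEnd (3 / 2)) atTop :=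
    Real.tendsto_exp_atTop.comp (tendsto_re_stripEnd _)
  rw [halfEnd, tendsto_inf, tendsto_comap_iff, tendsto_principal]
  constructor
  · exact h1.congr fun u => (norm_exp u).symm
  · have hc : 0 < Real.cos (3 / 2) :=
      Real.cos_pos_of_mem_Ioo ⟨by linarith [Real.pi_gt_three], by linarith [Real.pi_gt_three]⟩
    filter_upwards [(h1.atTop_mul_const hc).eventually_gt_atTop R, eventually_im_stripEnd _]
      with u hu him
    rw [halfPlane, mem_ofPred_eq, exp_re]
    refine hu.trans_le ?_
    gcongr
    rw [← Real.cos_abs u.im]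
    exact Real.cos_le_cos_of_nonneg_of_le_pi (abs_nonneg _) (by linarith [Real.pi_gt_three]) him.le

lemma half_norm_le_norm_exp_sub_one {x : ℂ} (hx : ‖x‖ ≤ 1 / 2) : ‖x‖ / 2 ≤ ‖exp x - 1‖ := by
  have h1 := norm_exp_sub_one_sub_id_le (hx.trans (by norm_num))
  have h2 := norm_sub_norm_le x (x - (exp x - 1))
  rw [sub_sub_cancel, norm_sub_rev x] at h2
  nlinarith [norm_nonneg x]

/-- Near the right end of a strip, `u ↦ Φ (e ^ u)` is injective at small scale. -/
lemma exists_strip_injective [CompleteSpace E] {Φ : ℂ → E} {R σ : ℝ} {y : E} (hσ : 0 < σ)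
    (hy : y ≠ 0) (hd : DifferentiableOn ℂ Φ (halfPlane R))
    (hl : Tendsto (fun t => exp ((σ : ℂ) * log t) • Φ t) (halfEnd R) (𝓝 y)) :
    ∃ S, ∀ u₁ ∈ strip (1 / 2) S, ∀ u₂ ∈ strip (1 / 2) S, ‖σ * (u₂ - u₁)‖ ≤ 1 / 2 →
      Φ (exp u₁) = Φ (exp u₂) → u₁ = u₂ := by
  set Y : ℂ → E := fun u => exp ((σ : ℂ) * u) • Φ (exp u) with hY
  have hy0 : 0 < ‖y‖ := norm_pos_iff.2 hy
  have hYl : Tendsto Y (stripEnd (3 / 2)) (𝓝 y) := by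
    refine (hl.comp (tendsto_exp_halfEnd R)).congr' ?_
    filter_upwards [eventually_im_stripEnd _] with u hu
    have := abs_lt.1 hu
    have hp := Real.pi_gt_three
    simp only [Function.comp_apply, hY]
    rw [log_exp (by linarith) (by linarith)]
  have hYd : ∀ᶠ u in stripEnd (3 / 2), DifferentiableAt ℂ Y u := by
    filter_upwards [(tendsto_exp_halfEnd R).eventually (eventually_mem_halfEnd R)] with u hu
    exact DifferentiableAt.smul (by fun_prop) (DifferentiableAt.comp (f := exp) u
      (hd.differentiableAt ((isOpen_halfPlane R).mem_nhds hu)) differentiableAt_exp)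
  set η : ℝ := min (σ / 16) (1 / 2) * ‖y‖ with hη
  have hη0 : 0 < η := by positivity
  have hη1 : η ≤ σ / 16 * ‖y‖ := by rw [hη]; gcongr; exact min_le_left _ _
  have hη2 : η ≤ 1 / 2 * ‖y‖ := by rw [hη]; gcongr; exact min_le_right _ _
  have hev := hYd.and (hYl.eventually (ball_mem_nhds y hη0))
  rw [show (3 / 2 : ℝ) = 1 / 2 + 1 by norm_num] at hev
  obtain ⟨S, hS⟩ := eventually_stripEnd.1 (eventually_stripEnd_ball hev)
  have hder : ∀ u ∈ strip (1 / 2) S, ‖deriv Y u‖ ≤ 2 * η := fun u hu => by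
    have h1 : DifferentiableOn ℂ Y (ball u 1) := fun w hw => (hS u hu w hw).1.differentiableWithinAt
    have h2 := norm_deriv_le_div_of_mapsTo_ball h1 (R₂ := 2 * η) (fun w hw => ?_) one_pos
    · rwa [div_one] at h2
    · have h3 := (hS u hu w hw).2
      have h4 := (hS u hu u (mem_ball_self one_pos)).2
      rw [mem_closedBall]
      linarith [dist_triangle_right (Y w) (Y u) y]
  refine ⟨S, fun u₁ h₁ u₂ h₂ hsmall heq => ?_⟩
  have hmv := (convex_strip (1 / 2) S).norm_image_sub_le_of_norm_deriv_le
    (fun u hu => (hS u hu u (mem_ball_self one_pos)).1) hder h₁ h₂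
  have hYe : Y u₂ - Y u₁ = (exp (σ * (u₂ - u₁)) - 1) • Y u₁ := by
    simp only [hY, heq]
    rw [sub_smul, one_smul, smul_smul, ← exp_add]
    congr 3
    ring
  have hYn : ‖y‖ / 2 ≤ ‖Y u₁‖ := by
    have h3 := (hS u₁ h₁ u₁ (mem_ball_self one_pos)).2
    rw [dist_eq_norm, norm_sub_rev] at h3
    linarith [norm_sub_norm_le y (Y u₁)]
  rw [hYe, norm_smul] at hmv
  have h5 := half_norm_le_norm_exp_sub_one hsmall
  rw [norm_mul, norm_real, Real.norm_of_nonneg hσ.le] at h5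
  have h6 : σ * ‖u₂ - u₁‖ / 2 * (‖y‖ / 2) ≤ 2 * η * ‖u₂ - u₁‖ :=
    (mul_le_mul h5 hYn (by positivity) (norm_nonneg _)).trans hmv
  have h7 : 2 * η * ‖u₂ - u₁‖ ≤ 2 * (σ / 16 * ‖y‖) * ‖u₂ - u₁‖ := by gcongr
  have h8 : σ * ‖y‖ * ‖u₂ - u₁‖ ≤ 0 := by nlinarith
  have h9 : ‖u₂ - u₁‖ ≤ 0 := by
    by_contra! h
    have : 0 < σ * ‖y‖ * ‖u₂ - u₁‖ := by positivity
    linarith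
  exact (sub_eq_zero.1 (norm_le_zero_iff.1 h9)).symm

lemma injOn_of_leading [CompleteSpace E] {f : E → E} {Φ : ℂ → E} {R σ : ℝ} {y : E} (hσ : 0 < σ)
    (hy : y ≠ 0) (hR : 0 < R) (hd : DifferentiableOn ℂ Φ (halfPlane R))
    (hΦ : ∀ t ∈ halfPlane R, f (Φ t) = Φ (t + 1))
    (hl : Tendsto (fun t => exp ((σ : ℂ) * log t) • Φ t) (halfEnd R) (𝓝 y)) :
    InjOn Φ (halfPlane R) := by
  intro t₁ h₁ t₂ h₂ h
  obtain ⟨S, hS⟩ := exists_strip_injective hσ hy hd hl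
  have hs := (hasBasis_stripEnd (1 / 2)).mem_of_mem (i := S) trivial
  have hlim : Tendsto (fun k : ℕ => ‖σ * (log (t₂ + k) - log (t₁ + k))‖) atTop (𝓝 0) := by
    have := (((tendsto_log_add_natCast_sub t₂).sub (tendsto_log_add_natCast_sub t₁)).const_mul
      (σ : ℂ)).norm
    simpa using this
  obtain ⟨k, hk1, hk2, hk3⟩ :=
    (((tendsto_log_add_natCast_stripEnd t₁ one_half_pos).eventually hs).and
    (((tendsto_log_add_natCast_stripEnd t₂ one_half_pos).eventually hs).and
    (hlim.eventually_le_const one_half_pos))).exists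
  have hne : ∀ t ∈ halfPlane R, t + (k : ℂ) ≠ 0 := fun t ht h0 => by
    have := add_natCast_mem_halfPlane ht k
    simp only [halfPlane, mem_ofPred_eq, h0, zero_re] at this
    linarith
  have := hS _ hk1 _ hk2 hk3 (by
    rw [exp_log (hne _ h₁), exp_log (hne _ h₂), apply_add_natCast_eq hΦ hΦ h₁ h₂ h k])
  have := congrArg exp this
  rw [exp_log (hne _ h₁), exp_log (hne _ h₂)] at this
  exact add_right_cancel this

lemma tendsto_zero_of_leading {Φ : ℂ → E} {R σ : ℝ} {y : E} (hσ : 0 < σ)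
    (hl : Tendsto (fun t => exp ((σ : ℂ) * log t) • Φ t) (halfEnd R) (𝓝 y)) :
    Tendsto Φ (halfEnd R) (𝓝 0) := by
  have h1 : Tendsto (fun t => (exp ((σ : ℂ) * log t))⁻¹) (halfEnd R) (𝓝 0) := by
    rw [tendsto_zero_iff_norm_tendsto_zero]
    refine ((tendsto_rpow_neg_atTop hσ).comp (tendsto_norm_halfEnd R)).congr' ?_
    filter_upwards [(tendsto_norm_halfEnd R).eventually_gt_atTop 0] with t ht
    rw [norm_inv, norm_exp_mul_log σ ht, Function.comp_apply, Real.rpow_neg ht.le]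
  have h2 := h1.smul hl
  rw [zero_smul] at h2
  exact h2.congr fun t => inv_smul_smul₀ (exp_ne_zero _) _

/-- The image of the half-plane `Re t > R` under `t ↦ 1 / t`. -/
def disc (R : ℝ) : Set ℂ := ball (((2 * R)⁻¹ : ℝ) : ℂ) (2 * R)⁻¹

lemma mem_disc_iff {R : ℝ} (hR : 0 < R) {ζ : ℂ} : ζ ∈ disc R ↔ ζ⁻¹ ∈ halfPlane R := by
  rcases eq_or_ne ζ 0 with rfl | hζ
  · simp [disc, halfPlane, abs_of_pos hR, hR.le]
  have h0 : 0 < normSq ζ := normSq_pos.2 hζ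
  rw [disc, mem_ball, dist_eq_norm, halfPlane, mem_ofPred_eq, inv_re, lt_div_iff₀ h0,
    ← sq_lt_sq₀ (norm_nonneg _) (by positivity), ← normSq_eq_norm_sq, normSq_apply, normSq_apply]
  simp only [sub_re, sub_im, ofReal_re, ofReal_im, sub_zero]
  have h1 : R * (2 * R)⁻¹ = 1 / 2 := by field_simp
  set c := (2 * R)⁻¹
  have hc : 0 < c := by positivity
  constructor
  · intro h
    have : ζ.re * ζ.re + ζ.im * ζ.im < 2 * c * ζ.re := by nlinarith
    nlinarith
  · intro h
    have : 2 * c * (R * (ζ.re * ζ.re + ζ.im * ζ.im)) < 2 * c * ζ.re := by gcongr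
    nlinarith

lemma image_inv_disc {α : Type*} {R : ℝ} (hR : 0 < R) (Φ : ℂ → α) :
    (fun ζ => Φ ζ⁻¹) '' disc R = Φ '' halfPlane R := by
  ext z
  constructor
  · rintro ⟨ζ, hζ, rfl⟩
    exact ⟨ζ⁻¹, (mem_disc_iff hR).1 hζ, rfl⟩
  · rintro ⟨t, ht, rfl⟩
    exact ⟨t⁻¹, (mem_disc_iff hR).2 (by rwa [inv_inv]), by simp⟩

lemma zero_notMem_disc {R : ℝ} (hR : 0 < R) : (0 : ℂ) ∉ disc R := by
  rw [mem_disc_iff hR]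
  simp [halfPlane, hR.le]

lemma tendsto_inv_disc {R : ℝ} (hR : 0 < R) : Tendsto (·⁻¹) (𝓝[disc R] (0 : ℂ)) (halfEnd R) := by
  rw [halfEnd, tendsto_inf, tendsto_comap_iff, tendsto_principal]
  constructor
  · have h : 𝓝[disc R] (0 : ℂ) ≤ 𝓝[≠] 0 :=
      nhdsWithin_mono _ fun ζ hζ h0 => zero_notMem_disc hR (h0 ▸ hζ)
    exact (tendsto_norm_cobounded_atTop.comp tendsto_inv₀_nhdsNE_zero).mono_left h
  · filter_upwards [self_mem_nhdsWithin] with ζ hζ using (mem_disc_iff hR).1 hζ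

lemma tendsto_projectivization_mk {n : ℕ} {ι : Type*} {l : Filter ι} {φ : ι → Fin n → ℂ}
    {a : ι → ℂ} {v : Fin n → ℂ} (hv : v ≠ 0) {c : ℂ} (hc : c ≠ 0)
    (h : Tendsto (fun i => a i • φ i) l (𝓝 (c • v))) :
    Tendsto (fun i => if h : φ i ≠ 0 then Projectivization.mk ℂ (φ i) h
      else Projectivization.mk ℂ v hv) l (𝓝 (Projectivization.mk ℂ v hv)) := by
  have hcv : c • v ≠ 0 := smul_ne_zero hc hv
  have hmk : Continuous fun x : {x : Fin n → ℂ // x ≠ 0} => Projectivization.mk ℂ x.1 x.2 :=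
    continuous_quotient_mk'
  have hχ : Tendsto (fun i => if h : a i • φ i ≠ 0 then (⟨a i • φ i, h⟩ : {x : Fin n → ℂ // x ≠ 0})
      else ⟨c • v, hcv⟩) l (𝓝 ⟨c • v, hcv⟩) := by
    rw [tendsto_subtype_rng]
    refine h.congr' ?_
    filter_upwards [h.eventually_ne hcv] with i hi
    rw [dif_pos hi]
  have hlim := (hmk.tendsto _).comp hχ
  have he : Projectivization.mk ℂ (c • v) hcv = Projectivization.mk ℂ v hv :=
    (Projectivization.mk_eq_mk_iff' ℂ _ _ _ _).2 ⟨c, rfl⟩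
  dsimp only at hlim
  rw [he] at hlim
  refine hlim.congr' ?_
  filter_upwards [h.eventually_ne hcv] with i hi
  have hi' : φ i ≠ 0 := fun h0 => hi (by rw [h0, smul_zero])
  rw [Function.comp_apply, dif_pos hi, dif_pos hi']
  exact (Projectivization.mk_eq_mk_iff' ℂ _ _ _ _).2 ⟨a i, rfl⟩

lemma isParabolicCurve_of_leading {n : ℕ} {f : (Fin n → ℂ) → Fin n → ℂ} {U : Set (Fin n → ℂ)}
    {Φ : ℂ → Fin n → ℂ} {R σ : ℝ} (hσ : 0 < σ) (hR : 0 < R) {v : Fin n → ℂ} (hv : v ≠ 0) {c : ℂ}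
    (hc : c ≠ 0) (hd : DifferentiableOn ℂ Φ (halfPlane R))
    (hΦ : ∀ t ∈ halfPlane R, f (Φ t) = Φ (t + 1))
    (hl : Tendsto (fun t => exp ((σ : ℂ) * log t) • Φ t) (halfEnd R) (𝓝 (c • v)))
    (hΦ0 : ∀ t ∈ halfPlane R, Φ t ≠ 0) (hΦU : ∀ t ∈ halfPlane R, Φ t ∈ U) :
    IsParabolicCurve f U (disc R) (fun ζ => Φ ζ⁻¹) v hv := by
  have hc0 : 0 < (2 * R)⁻¹ := by positivity
  have hne : (disc R).Nonempty := nonempty_ball.2 hc0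
  have hconv : Convex ℝ (disc R) := convex_ball _ _
  have hinv : ∀ ζ ∈ disc R, ζ⁻¹ ∈ halfPlane R := fun ζ => (mem_disc_iff hR).1
  have hcontr := hconv.contractibleSpace hne
  have hlim0 := tendsto_zero_of_leading hσ hl
  refine ⟨isOpen_ball, hne, hconv.isConnected hne, inferInstance, ?_, zero_notMem_disc hR, ?_, ?_,
    fun ζ hζ => hΦ0 _ (hinv ζ hζ), ?_, hlim0.comp (tendsto_inv_disc hR), ?_, ?_, ?_⟩
  · rw [disc, frontier_ball _ hc0.ne', mem_sphere, dist_comm, dist_zero_right, norm_real,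
      Real.norm_of_nonneg hc0.le]
  · refine hd.comp (fun ζ hζ => ?_) hinv
    exact (differentiableAt_inv fun h0 => zero_notMem_disc hR (h0 ▸ hζ)).differentiableWithinAt
  · exact (injOn_of_leading hσ (smul_ne_zero hc hv) hR hd hΦ hl).comp inv_injective.injOn hinv
  · rw [image_inv_disc hR]
    rintro _ ⟨t, ht, rfl⟩
    exact hΦU t ht
  · rw [image_inv_disc hR]
    rintro _ ⟨t, ht, rfl⟩
    exact ⟨t + 1, add_one_mem_halfPlane ht, (hΦ t ht).symm⟩
  · rw [image_inv_disc hR]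
    intro K hK _
    rw [Metric.tendstoUniformlyOn_iff]
    intro ε hε
    obtain ⟨S, hS⟩ :=
      (forall_halfPlane_of_eventually (hlim0.eventually (ball_mem_nhds 0 hε))).exists
    filter_upwards [tendsto_natCast_atTop_atTop.eventually_ge_atTop S] with k hk z hz
    obtain ⟨t, ht, rfl⟩ := hK hz
    rw [iterate_eq_add_natCast hΦ ht, dist_comm]
    refine hS _ ?_
    have ht' : R < t.re := ht
    simp only [halfPlane, mem_ofPred_eq, add_re, natCast_re]
    linarith
  · exact tendsto_projectivization_mk hv hc
      (hl.comp (tendsto_inv_disc hR))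

lemma exists_injective_pow_eq {m : ℕ} (hm : m ≠ 0) {w : ℂ} (hw : w ≠ 0) :
    ∃ c : Fin m → ℂ, Function.Injective c ∧ ∀ j, c j ^ m = w := by
  obtain ⟨c₀, hc₀⟩ := IsAlgClosed.exists_pow_nat_eq w (Nat.pos_of_ne_zero hm)
  have hc0 : c₀ ≠ 0 := fun h => hw (by rw [← hc₀, h, zero_pow hm])
  have hprim := isPrimitiveRoot_exp m hm
  refine ⟨fun j => c₀ * exp (2 * Real.pi * I / m) ^ (j : ℕ), fun j k hjk => ?_, fun j => ?_⟩
  · exact Fin.ext (hprim.pow_inj j.2 k.2 (mul_left_cancel₀ hc0 hjk))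
  · rw [mul_pow, hc₀, ← pow_mul, mul_comm (j : ℕ), pow_mul, hprim.pow_eq_one, one_pow, mul_one]

lemma eval_smul_of_isHomogeneous {ι : Type*} {p : MvPolynomial ι ℂ} {d : ℕ}
    (hp : p.IsHomogeneous d) (s : ℂ) (y : ι → ℂ) :
    MvPolynomial.eval (s • y) p = s ^ d * MvPolynomial.eval y p := by
  rw [MvPolynomial.eval_eq, MvPolynomial.eval_eq, Finset.mul_sum]
  refine Finset.sum_congr rfl fun k hk => ?_
  simp only [Pi.smul_apply, smul_eq_mul, mul_pow]
  rw [Finset.prod_mul_distrib, Finset.prod_pow_eq_pow_sum,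
    ← hp.degree_eq_sum_deg_support hk]
  ring

/-- For each admissible multiple `c • v` of the characteristic direction, there is a parabolic
curve, parametrised by a half-plane, with leading coefficient `c • v`. -/
lemma exists_solution_with_leading {n m : ℕ} {f : (Fin n → ℂ) → Fin n → ℂ} {U : Set (Fin n → ℂ)}
    (hU : IsOpen U) (h0 : (0 : Fin n → ℂ) ∈ U) (hf : DifferentiableOn ℂ f U) (hm : m ≠ 0)
    {Q : Fin n → MvPolynomial (Fin n) ℂ} (hQhom : ∀ i, (Q i).IsHomogeneous (m + 1))
    (hexp : (fun z => f z - z - fun i => MvPolynomial.eval z (Q i))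
      =O[𝓝 0] fun z : Fin n → ℂ => ‖z‖ ^ (m + 2))
    {v : Fin n → ℂ} (hv : v ≠ 0) {lam c : ℂ}
    (hchar : (fun i => MvPolynomial.eval v (Q i)) = lam • v) (hc : c ≠ 0)
    (hclam : c ^ m * lam = -((m : ℝ)⁻¹ : ℝ)) :
    ∃ (Φ : ℂ → Fin n → ℂ) (R : ℝ), 0 < R ∧ DifferentiableOn ℂ Φ (halfPlane R) ∧
      (∀ t ∈ halfPlane R, f (Φ t) = Φ (t + 1)) ∧
      Tendsto (fun t => exp (((m : ℝ)⁻¹ : ℝ) * log t) • Φ t) (halfEnd R) (𝓝 (c • v)) ∧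
      (∀ t ∈ halfPlane R, Φ t ≠ 0) ∧ ∀ t ∈ halfPlane R, Φ t ∈ U := by
  have hm0 : (0 : ℝ) < m := by exact_mod_cast Nat.pos_of_ne_zero hm
  have hm1 : (1 : ℝ) ≤ m := by exact_mod_cast Nat.pos_of_ne_zero hm
  have hσ : 0 < (m : ℝ)⁻¹ := inv_pos.2 hm0
  set P : (Fin n → ℂ) → Fin n → ℂ := fun z i => MvPolynomial.eval z (Q i) with hP
  have hPs : ContDiff ℂ 2 P := contDiff_pi.2 fun i =>
    contDiffOn_univ.1 ((AnalyticOnNhd.eval_mvPolynomial (Q i)).contDiffOn uniqueDiffOn_univ)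
  have hhom : ∀ (s : ℂ) y, P (s • y) = s ^ (m + 1) • P y := fun s y => by
    ext i
    simp only [hP, Pi.smul_apply, smul_eq_mul]
    exact eval_smul_of_isHomogeneous (hQhom i) s y
  have hH : ∀ᶠ z in 𝓝 (0 : Fin n → ℂ), DifferentiableAt ℂ (fun z => f z - z) z := by
    filter_upwards [hU.mem_nhds h0] with z hz
    exact (hf.differentiableAt (hU.mem_nhds hz)).sub differentiableAt_id
  have hPy : P (c • v) = -(((m : ℝ)⁻¹ : ℝ) : ℂ) • (c • v) := by
    rw [hhom, show P v = lam • v from hchar, smul_smul, smul_smul, ← hclam]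
    congr 1
    ring
  obtain ⟨Φ, hΦ⟩ := exists_holomorphic_solution (m := m) hH hPs hhom hexp
    (mul_inv_cancel₀ hm0.ne') hσ (c • v) hPy (inv_le_one_of_one_le₀ hm1)
  obtain ⟨R₀, hR₀⟩ := hΦ.exists
  have hne : ∀ᶠ t in halfEnd R₀, Φ t ≠ 0 := by
    filter_upwards [hR₀.2.2.eventually_ne (smul_ne_zero hc hv)] with t ht h
    exact ht (by rw [h, smul_zero])
  have hmem : ∀ᶠ t in halfEnd R₀, Φ t ∈ U :=
    (tendsto_zero_of_leading hσ hR₀.2.2).eventually (hU.mem_nhds h0)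
  obtain ⟨R, ⟨h1, h2, h3⟩, h4, h5, h6⟩ := (hΦ.and ((forall_halfPlane_of_eventually hne).and
    ((forall_halfPlane_of_eventually hmem).and (eventually_gt_atTop 0)))).exists
  exact ⟨Φ, R, h6, h1, fun t ht => by rw [h2 t ht, add_sub_cancel], h3, h4, h5⟩

end EcalleHakim

/-- **Écalle–Hakim theorem.** Let `f` be a holomorphic local dynamical system at `O ∈ ℂⁿ`
tangent to the identity of order `ν ≥ 2`, with first non-zero homogeneous term `P_ν` given by
the `n`-tuple `Q` of homogeneous polynomials of degree `ν`. Then for any non-degenerate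
characteristic direction `[v]` (i.e. `P_ν(v) = λ v` with `λ ≠ 0`) there exist at least `ν - 1`
(pairwise disjoint) parabolic curves for `f` tangent to `[v]`. -/
theorem ecalle_hakim_parabolic_curves
    {n : ℕ} (hn : 1 ≤ n)
    (f : (Fin n → ℂ) → Fin n → ℂ) (U : Set (Fin n → ℂ))
    (hU : IsOpen U) (h0 : (0 : Fin n → ℂ) ∈ U)
    (hf : DifferentiableOn ℂ f U) (hf0 : f 0 = 0) (hfne : ∃ z ∈ U, f z ≠ z)
    (ν : ℕ) (hν : 2 ≤ ν)
    (Q : Fin n → MvPolynomial (Fin n) ℂ)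
    (hQhom : ∀ i, (Q i).IsHomogeneous ν) (hQne : ∃ i, Q i ≠ 0)
    -- homogeneous expansion: f(z) = z + P_ν(z) + O(‖z‖^{ν+1}), with P_ν given by Q
    (hexp : (fun z => f z - z - fun i => MvPolynomial.eval z (Q i))
      =O[𝓝 0] fun z : Fin n → ℂ => ‖z‖ ^ (ν + 1))
    (v : Fin n → ℂ) (hv : v ≠ 0) (lam : ℂ) (hlam : lam ≠ 0)
    (hchar : (fun i => MvPolynomial.eval v (Q i)) = lam • v) :
    ∃ (Δ : Fin (ν - 1) → Set ℂ) (φ : Fin (ν - 1) → ℂ → Fin n → ℂ),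
      (∀ j, IsParabolicCurve f U (Δ j) (φ j) v hv) ∧
      ∀ j k, j ≠ k → Disjoint (φ j '' Δ j) (φ k '' Δ k) := by
  obtain ⟨m, rfl⟩ : ∃ m, ν = m + 1 := ⟨ν - 1, by omega⟩
  have hm : m ≠ 0 := by omega
  have hmC : (((m : ℝ)⁻¹ : ℝ) : ℂ) ≠ 0 := by
    exact_mod_cast inv_ne_zero (Nat.cast_ne_zero.2 hm)
  have hw : -(((m : ℝ)⁻¹ : ℝ) : ℂ) / lam ≠ 0 := div_ne_zero (neg_ne_zero.2 hmC) hlam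
  obtain ⟨c, hcinj, hcpow⟩ := EcalleHakim.exists_injective_pow_eq hm hw
  have hc0 : ∀ j, c j ≠ 0 := fun j h => hw (by rw [← hcpow j, h, zero_pow hm])
  choose Φ R hR hd hΦ hl hΦ0 hΦU using fun j => EcalleHakim.exists_solution_with_leading hU h0 hf hm
    hQhom hexp hv hchar (hc0 j) (by rw [hcpow j, div_mul_cancel₀ _ hlam])
  have hσ : 0 < (m : ℝ)⁻¹ := inv_pos.2 (by exact_mod_cast Nat.pos_of_ne_zero hm)
  refine ⟨fun j => EcalleHakim.disc (R j), fun j ζ => Φ j ζ⁻¹, fun j => ?_, fun j k hjk => ?_⟩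
  · exact EcalleHakim.isParabolicCurve_of_leading hσ (hR j) hv (hc0 j) (hd j) (hΦ j) (hl j) (hΦ0 j)
      (hΦU j)
  · rw [EcalleHakim.image_inv_disc (hR j), EcalleHakim.image_inv_disc (hR k)]
    exact EcalleHakim.disjoint_image_of_leading_ne (hΦ j) (hΦ k) (hl j) (hl k)
      fun h => hjk (hcinj (smul_left_injective ℂ hv h))
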